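/- Let n ≥ 1 and ν > 0. Suppose u₀ ∈ C(ℝⁿ) satisfies δ := inf_{ℝⁿ} u₀ > 0 and u₀(x) ≤ C₁ e^{C₂|x|²} on ℝⁿ for some constants C₁ > 0 and C₂ > 0. Then there exists a constant T > 0 such that there exists a unique solution u of the Cauchy problem u_t = Δu − u^{−ν} on ℝⁿ × (0,T) with initial value u₀ satisfying the heat-kernel representation u(x,t) = ∫_{ℝⁿ} (4πt)^{−n/2} e^{−|x−y|²/(4t)} u₀(y) dy − ∫₀ᵗ ∫_{ℝⁿ} (4π(t−s))^{−n/2} e^{−|x−y|²/(4(t−s))} u(y,s)^{−ν} dy ds on ℝⁿ × (0,T). Moreover, if in addition u₀(x) ≤ C₃(1+|x|²)^{α} on ℝⁿ for some constants C₃ > 0 and α ≥ 1/(1+ν), then the maximal such T satisfies T ≥ (δ/2)^{1+ν}, and if the maximal T is finite then lim_{t↗T} inf_{ℝⁿ} u(·,t) = 0. -/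

import Mathlib

open MeasureTheory Real Set Filter Topology Metric

noncomputable section

/-- Euclidean space `ℝⁿ`. -/
abbrev E (n : ℕ) := EuclideanSpace ℝ (Fin n)

/-- Second partial derivative `∂²f/∂xᵢ∂xⱼ` of `f : ℝⁿ → ℝ`. -/
def pd2 {n : ℕ} (f : E n → ℝ) (i j : Fin n) (x : E n) : ℝ :=
  fderiv ℝ (fun y => fderiv ℝ f y (EuclideanSpace.single j (1 : ℝ))) x
    (EuclideanSpace.single i (1 : ℝ))

/-- Spatial Laplacian of `f : ℝⁿ → ℝ`. -/
def lap {n : ℕ} (f : E n → ℝ) (x : E n) : ℝ := ∑ i, pd2 f i i x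

/-- `u = u(x,t)` is of class `C^{2,1}` on a set `S ⊆ ℝⁿ × ℝ`: `u`, `∂u/∂t` and
all first and second spatial derivatives are continuous on `S`. -/
structure IsC21 {n : ℕ} (S : Set (E n × ℝ)) (u : E n → ℝ → ℝ) : Prop where
  cont : ContinuousOn (fun p : E n × ℝ => u p.1 p.2) S
  cont_t : ContinuousOn (fun p : E n × ℝ => deriv (u p.1) p.2) S
  cont_x : ∀ i : Fin n, ContinuousOn
    (fun p : E n × ℝ =>
      fderiv ℝ (fun y => u y p.2) p.1 (EuclideanSpace.single i (1 : ℝ))) S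
  cont_xx : ∀ i j : Fin n, ContinuousOn
    (fun p : E n × ℝ => pd2 (fun y => u y p.2) i j p.1) S

/-- A solution of the Cauchy problem `u_t = Δu - u^{-ν}` on `ℝⁿ × (0,T)` with
initial value `u₀`. -/
structure IsCauchySol (n : ℕ) (ν T : ℝ) (u₀ : E n → ℝ) (u : E n → ℝ → ℝ) : Prop where
  pos : ∀ (x : E n), ∀ t ∈ Ioo (0 : ℝ) T, 0 < u x t
  reg : IsC21 ((univ : Set (E n)) ×ˢ Ioo (0 : ℝ) T) u
  eqn : ∀ (x : E n), ∀ t ∈ Ioo (0 : ℝ) T,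
    deriv (u x) t = lap (fun y => u y t) x - u x t ^ (-ν)
  init : ∀ K : Set (E n), IsCompact K →
    Tendsto (fun t => ∫ x in K, |u x t - u₀ x|) (𝓝[>] (0 : ℝ)) (𝓝 0)
  bound : ∀ δ ∈ Ioo (0 : ℝ) T, ∃ C₁ C₂ : ℝ, 0 < C₁ ∧ 0 < C₂ ∧
    ∀ (x : E n), ∀ t ∈ Ioo (0 : ℝ) (T - δ),
      C₁ * (1 + ‖x‖ ^ 2) ^ (-(1 / (1 + ν))) ≤ u x t ∧
      u x t ≤ C₂ * Real.exp (C₂ * ‖x‖ ^ 2)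

/-- A solution of the Cauchy problem on `ℝⁿ × (0,∞)`: a solution on `ℝⁿ × (0,T)`
for every `T > 0`. -/
def IsGlobalSol (n : ℕ) (ν : ℝ) (u₀ : E n → ℝ) (u : E n → ℝ → ℝ) : Prop :=
  ∀ T > (0 : ℝ), IsCauchySol n ν T u₀ u

/-- The heat kernel on `ℝⁿ`. -/
def heatKernel (n : ℕ) (t : ℝ) (z : E n) : ℝ :=
  (4 * π * t) ^ (-(n : ℝ) / 2) * Real.exp (-‖z‖ ^ 2 / (4 * t))

/-- `u` satisfies the heat-kernel (Duhamel) representation formula for the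
equation `u_t = Δu - u^{-ν}` on `ℝⁿ × (0,T)`. -/
def HeatRepr (n : ℕ) (ν T : ℝ) (u₀ : E n → ℝ) (u : E n → ℝ → ℝ) : Prop :=
  ∀ (x : E n), ∀ t ∈ Ioo (0 : ℝ) T,
    u x t = (∫ y : E n, heatKernel n t (x - y) * u₀ y) -
      ∫ s in Ioo (0 : ℝ) t, ∫ y : E n, heatKernel n (t - s) (x - y) * u y s ^ (-ν)

section gauss
variable {n : ℕ}

/-- The normalized Gaussian (heat kernel at time one). -/
def gk (n : ℕ) (z : E n) : ℝ := (4 * π) ^ (-(n : ℝ) / 2) * Real.exp (-‖z‖ ^ 2 / 4)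

/-- Gaussian with polynomial and exponential slack. -/
def wk (n : ℕ) (z : E n) : ℝ := gk n z * (1 + ‖z‖) ^ 2 * Real.exp (‖z‖ ^ 2 / 8)

/-- Total mass of `wk`. -/
def KK (n : ℕ) : ℝ := ∫ z : E n, wk n z

lemma gk_pos (z : E n) : 0 < gk n z := by unfold gk; positivity

lemma gk_cont : Continuous (gk n) := by unfold gk; fun_prop

lemma wk_pos (z : E n) : 0 < wk n z := by
  have := gk_pos z
  have h2 : 0 < 1 + ‖z‖ := by positivity
  unfold wk; positivity

lemma wk_cont : Continuous (wk n) := by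
  have := gk_cont (n := n)
  unfold wk; fun_prop

lemma integrable_gauss {b : ℝ} (hb : 0 < b) :
    Integrable (fun z : E n => Real.exp (-b * ‖z‖ ^ 2)) := by
  have := GaussianFourier.integrable_cexp_neg_mul_sq_norm_add (V := E n) (b := (b : ℂ)) (by simpa) 0 0
  have h2 := this.norm
  refine h2.congr (Filter.Eventually.of_forall fun z => ?_)
  simp [Complex.norm_exp, ← Complex.ofReal_pow]

lemma integral_gk : ∫ z : E n, gk n z = 1 := by
  unfold gk
  rw [integral_const_mul]
  have h := GaussianFourier.integral_rexp_neg_mul_sq_norm (V := E n) (b := 1/4) (by norm_num)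
  have h2 : ∀ z : E n, -‖z‖ ^ 2 / 4 = -(1/4) * ‖z‖ ^ 2 := fun z => by ring
  simp_rw [h2]
  rw [h, finrank_euclideanSpace, Fintype.card_fin, show π / (1/4) = 4 * π by ring,
    ← rpow_add (by positivity), show -(n : ℝ) / 2 + n / 2 = 0 by ring, rpow_zero]

lemma wk_le (z : E n) : wk n z ≤ ((4 * π) ^ (-(n : ℝ) / 2) * 32) * Real.exp (-(1/16) * ‖z‖ ^ 2) := by
  have h1 : (1 + ‖z‖) ^ 2 ≤ 32 * Real.exp (‖z‖ ^ 2 / 16) := by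
    have := Real.add_one_le_exp (‖z‖ ^ 2 / 16)
    nlinarith [sq_nonneg (1 - ‖z‖), norm_nonneg z]
  have h2 : Real.exp (-(1/16) * ‖z‖ ^ 2) = Real.exp (-‖z‖ ^ 2 / 4) * Real.exp (‖z‖ ^ 2 / 16) * Real.exp (‖z‖ ^ 2 / 8) := by
    rw [← Real.exp_add, ← Real.exp_add]; congr 1; ring
  rw [h2]; unfold wk gk
  have h3 : 0 < (4 * π) ^ (-(n : ℝ) / 2) := by positivity
  calc _ = ((4 * π) ^ (-(n : ℝ) / 2) * Real.exp (-‖z‖ ^ 2 / 4) * Real.exp (‖z‖ ^ 2 / 8)) * (1 + ‖z‖) ^ 2 := by ring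
    _ ≤ ((4 * π) ^ (-(n : ℝ) / 2) * Real.exp (-‖z‖ ^ 2 / 4) * Real.exp (‖z‖ ^ 2 / 8)) * (32 * Real.exp (‖z‖ ^ 2 / 16)) := by gcongr
    _ = _ := by ring

lemma wk_integrable : Integrable (wk n) := by
  refine ((integrable_gauss (n := n) (b := 1/16) (by norm_num)).const_mul
    ((4 * π) ^ (-(n : ℝ) / 2) * 32)).mono' wk_cont.aestronglyMeasurable
    (Filter.Eventually.of_forall fun z => ?_)
  rw [Real.norm_of_nonneg (wk_pos z).le]
  exact wk_le z

lemma gk_le_wk (z : E n) : gk n z ≤ wk n z := by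
  have h := gk_pos z
  unfold wk
  have h1 : 1 ≤ (1 + ‖z‖) ^ 2 := by nlinarith [norm_nonneg z]
  have h2 : 1 ≤ Real.exp (‖z‖ ^ 2 / 8) := Real.one_le_exp (by positivity)
  calc gk n z = gk n z * 1 * 1 := by ring
    _ ≤ _ := by gcongr

lemma gk_integrable : Integrable (gk n) :=
  wk_integrable.mono' gk_cont.aestronglyMeasurable
    (Filter.Eventually.of_forall fun z => by
      rw [Real.norm_of_nonneg (gk_pos z).le]; exact gk_le_wk z)

lemma one_le_KK : 1 ≤ KK n := by
  rw [← integral_gk (n := n)]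
  exact integral_mono gk_integrable wk_integrable gk_le_wk

lemma KK_pos : 0 < KK n := lt_of_lt_of_le one_pos one_le_KK

lemma norm_sub_sq_le (x z : E n) (r : ℝ) : ‖x - r • z‖ ^ 2 ≤ 2 * ‖x‖ ^ 2 + 2 * r ^ 2 * ‖z‖ ^ 2 := by
  have h : ‖x - r • z‖ ≤ ‖x‖ + |r| * ‖z‖ := by
    refine (norm_sub_le _ _).trans ?_
    rw [norm_smul, Real.norm_eq_abs]
  have h2 : (|r| * ‖z‖) ^ 2 = r ^ 2 * ‖z‖ ^ 2 := by rw [mul_pow, sq_abs]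
  have : 0 ≤ |r| * ‖z‖ := by positivity
  nlinarith [sq_nonneg (‖x‖ - |r| * ‖z‖), norm_nonneg (x - r • z), norm_nonneg x]

lemma exp_growth {a r : ℝ} (ha : 0 ≤ a) (har : 16 * a * r ^ 2 ≤ 1) (x z : E n) :
    Real.exp (a * ‖x - r • z‖ ^ 2) ≤ Real.exp (2 * a * ‖x‖ ^ 2) * Real.exp (‖z‖ ^ 2 / 8) := by
  rw [← Real.exp_add]
  apply Real.exp_le_exp.2
  have := mul_le_mul_of_nonneg_left (norm_sub_sq_le x z r) ha
  nlinarith [mul_le_mul_of_nonneg_right har (sq_nonneg ‖z‖)]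

variable {F : Type*} [NormedAddCommGroup F] [NormedSpace ℝ F]

/-- Gaussian average of `g` around `x` at scale `r` with weight `m`. -/
def AA (m : E n → ℝ) (r : ℝ) (g : E n → F) (x : E n) : F :=
  ∫ z : E n, (gk n z * m z) • g (x - r • z)

lemma AA_ptbound {m : E n → ℝ} (hm : ∀ z, |m z| ≤ (1 + ‖z‖) ^ 2) {a C r : ℝ} (ha : 0 ≤ a)
    (har : 16 * a * r ^ 2 ≤ 1) {g : E n → F} (hg : ∀ x, ‖g x‖ ≤ C * Real.exp (a * ‖x‖ ^ 2)) (x z : E n) :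
    ‖(gk n z * m z) • g (x - r • z)‖ ≤ (C * Real.exp (2 * a * ‖x‖ ^ 2)) * wk n z := by
  have hC : 0 ≤ C := by
    have := (norm_nonneg _).trans (hg 0)
    exact nonneg_of_mul_nonneg_left this (Real.exp_pos _)
  rw [norm_smul, norm_mul, Real.norm_of_nonneg (gk_pos z).le, Real.norm_eq_abs]
  have := gk_pos z
  calc gk n z * |m z| * ‖g (x - r • z)‖
      ≤ gk n z * (1 + ‖z‖) ^ 2 * (C * (Real.exp (2 * a * ‖x‖ ^ 2) * Real.exp (‖z‖ ^ 2 / 8))) := by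
        gcongr
        · exact hm z
        · exact (hg _).trans (by gcongr; exact exp_growth ha har x z)
    _ = _ := by unfold wk; ring

lemma AA_meas {m : E n → ℝ} (hmc : Continuous m) {g : E n → F} (hgc : Continuous g) (r : ℝ) (x : E n) :
    AEStronglyMeasurable (fun z : E n => (gk n z * m z) • g (x - r • z)) := by
  have := gk_cont (n := n)
  apply Continuous.aestronglyMeasurable
  fun_prop

lemma AA_integrable {m : E n → ℝ} (hmc : Continuous m) (hm : ∀ z, |m z| ≤ (1 + ‖z‖) ^ 2) {a C r : ℝ}
    (ha : 0 ≤ a) (har : 16 * a * r ^ 2 ≤ 1) {g : E n → F} (hgc : Continuous g)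
    (hg : ∀ x, ‖g x‖ ≤ C * Real.exp (a * ‖x‖ ^ 2)) (x : E n) :
    Integrable (fun z : E n => (gk n z * m z) • g (x - r • z)) :=
  (wk_integrable.const_mul _).mono' (AA_meas hmc hgc r x)
    (Filter.Eventually.of_forall fun z => AA_ptbound hm ha har hg x z)

lemma AA_norm_le {m : E n → ℝ} (hm : ∀ z, |m z| ≤ (1 + ‖z‖) ^ 2) {a C r : ℝ}
    (ha : 0 ≤ a) (har : 16 * a * r ^ 2 ≤ 1) {g : E n → F}
    (hg : ∀ x, ‖g x‖ ≤ C * Real.exp (a * ‖x‖ ^ 2)) (x : E n) :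
    ‖AA m r g x‖ ≤ KK n * C * Real.exp (2 * a * ‖x‖ ^ 2) := by
  unfold AA
  refine (norm_integral_le_of_norm_le (wk_integrable.const_mul _)
    (Filter.Eventually.of_forall fun z => AA_ptbound hm ha har hg x z)).trans (le_of_eq ?_)
  rw [integral_const_mul]; unfold KK; ring

lemma AA_cont {m : E n → ℝ} (hmc : Continuous m) (hm : ∀ z, |m z| ≤ (1 + ‖z‖) ^ 2) {a C : ℝ}
    (ha : 0 ≤ a) {I : Set ℝ} {f : E n → ℝ → F}
    (hfc : ContinuousOn (fun p : E n × ℝ => f p.1 p.2) (univ ×ˢ I))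
    (hf : ∀ x, ∀ s ∈ I, ‖f x s‖ ≤ C * Real.exp (a * ‖x‖ ^ 2)) :
    ContinuousOn (fun p : E n × ℝ × ℝ => AA m p.2.1 (fun y => f y p.2.2) p.1)
      (univ ×ˢ ({r | 16 * a * r ^ 2 ≤ 1} ×ˢ I)) := by
  intro p₀ hp₀
  have hC : 0 ≤ C := by
    have := (norm_nonneg _).trans (hf 0 p₀.2.2 hp₀.2.2)
    exact nonneg_of_mul_nonneg_left this (Real.exp_pos _)
  unfold AA
  have hfs : ∀ s ∈ I, Continuous (fun y => f y s) := fun s hs => by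
    rw [← continuousOn_univ]
    exact hfc.comp (f := fun y : E n => (y, s)) (by fun_prop) (fun y _ => ⟨mem_univ _, hs⟩)
  refine continuousWithinAt_of_dominated
    (bound := fun z => (C * Real.exp (2 * a * (‖p₀.1‖ + 1) ^ 2)) * wk n z) ?_ ?_
    (wk_integrable.const_mul _) ?_
  · filter_upwards [self_mem_nhdsWithin] with p hp
    exact AA_meas hmc (hfs _ hp.2.2) _ _
  · have h1 : ∀ᶠ p : E n × ℝ × ℝ in 𝓝[univ ×ˢ ({r | 16 * a * r ^ 2 ≤ 1} ×ˢ I)] p₀, ‖p.1‖ < ‖p₀.1‖ + 1 := by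
      apply mem_nhdsWithin_of_mem_nhds
      have : ContinuousAt (fun p : E n × ℝ × ℝ => ‖p.1‖) p₀ := by fun_prop
      exact this.eventually_lt continuousAt_const (by simp)
    filter_upwards [self_mem_nhdsWithin, h1] with p hp hp1
    refine Filter.Eventually.of_forall fun z => ?_
    refine (AA_ptbound hm ha hp.2.1 (fun x => hf x _ hp.2.2) p.1 z).trans ?_
    have := wk_pos z
    gcongr
  · refine Filter.Eventually.of_forall fun z => ?_
    refine ContinuousWithinAt.smul continuousWithinAt_const ?_
    have h := hfc (p₀.1 - p₀.2.1 • z, p₀.2.2) ⟨mem_univ _, hp₀.2.2⟩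
    refine ContinuousWithinAt.comp (f := fun p : E n × ℝ × ℝ => (p.1 - p.2.1 • z, p.2.2)) (x := p₀) h ?_ ?_
    · apply Continuous.continuousWithinAt; fun_prop
    · intro p hp; exact ⟨mem_univ _, hp.2.2⟩

lemma one_bd (z : E n) : |(fun _ : E n => (1 : ℝ)) z| ≤ (1 + ‖z‖) ^ 2 := by
  simp only [abs_one]; nlinarith [norm_nonneg z]

lemma coord_bd (j : Fin n) (z : E n) : |(fun z : E n => z j) z| ≤ (1 + ‖z‖) ^ 2 := by
  have := EuclideanSpace.norm_eq z
  have h : ‖z j‖ ≤ ‖z‖ := PiLp.norm_apply_le z j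
  rw [Real.norm_eq_abs] at h
  simp only; nlinarith [norm_nonneg z]

lemma coord_cont (j : Fin n) : Continuous (fun z : E n => z j) := by fun_prop

/-- Scaled heat semigroup. -/
abbrev PA (r : ℝ) (g : E n → F) (x : E n) : F := AA (fun _ => (1 : ℝ)) r g x

lemma PA_zero [CompleteSpace F] (g : E n → F) (x : E n) : PA 0 g x = g x := by
  unfold PA AA
  simp only [mul_one, zero_smul, sub_zero]
  rw [integral_smul_const, integral_gk, one_smul]

lemma PA_const [CompleteSpace F] (r : ℝ) (c : F) (x : E n) : PA r (fun _ => c) x = c := by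
  unfold PA AA
  simp only [mul_one]
  rw [integral_smul_const, integral_gk, one_smul]

lemma PA_mono {a C C' r : ℝ} (ha : 0 ≤ a) (har : 16 * a * r ^ 2 ≤ 1) {g h : E n → ℝ}
    (hgc : Continuous g) (hg : ∀ x, ‖g x‖ ≤ C * Real.exp (a * ‖x‖ ^ 2))
    (hhc : Continuous h) (hh : ∀ x, ‖h x‖ ≤ C' * Real.exp (a * ‖x‖ ^ 2)) (hgh : ∀ x, g x ≤ h x) (x : E n) :
    PA r g x ≤ PA r h x := by
  refine integral_mono (AA_integrable continuous_const one_bd ha har hgc hg x)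
    (AA_integrable continuous_const one_bd ha har hhc hh x) fun z => ?_
  have := gk_pos z
  simp only [mul_one, smul_eq_mul]
  gcongr; exact hgh _

lemma PA_sub {a C C' r : ℝ} (ha : 0 ≤ a) (har : 16 * a * r ^ 2 ≤ 1) {g h : E n → F}
    (hgc : Continuous g) (hg : ∀ x, ‖g x‖ ≤ C * Real.exp (a * ‖x‖ ^ 2))
    (hhc : Continuous h) (hh : ∀ x, ‖h x‖ ≤ C' * Real.exp (a * ‖x‖ ^ 2)) (x : E n) :
    PA r (fun y => g y - h y) x = PA r g x - PA r h x := by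
  unfold PA AA
  rw [← integral_sub (AA_integrable continuous_const one_bd ha har hgc hg x)
    (AA_integrable continuous_const one_bd ha har hhc hh x)]
  simp only [smul_sub]

/-- Pointwise domination of an average. -/
lemma PA_norm_le_of_le {r : ℝ} {g : E n → F} {h : E n → ℝ} (x : E n)
    (hh : Integrable (fun z : E n => (gk n z * 1) • h (x - r • z)))
    (hgh : ∀ y, ‖g y‖ ≤ h y) : ‖PA r g x‖ ≤ PA r h x := by
  refine norm_integral_le_of_norm_le hh (Filter.Eventually.of_forall fun z => ?_)
  have := gk_pos z
  rw [norm_smul, Real.norm_of_nonneg (by simpa using this.le), smul_eq_mul]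
  gcongr; exact hgh _

end gauss

section gauss2
variable {n : ℕ}

/-- Gradient of `PA r g` obtained by differentiating the kernel. -/
def DA (r : ℝ) (g : E n → ℝ) (x : E n) : E n →L[ℝ] ℝ :=
  (-(1 / (2 * r))) • ∑ j : Fin n, (AA (fun z : E n => z j) r g x) •
    (EuclideanSpace.proj j : E n →L[ℝ] ℝ)

lemma DA_apply (r : ℝ) (g : E n → ℝ) (x : E n) (i : Fin n) :
    DA r g x (EuclideanSpace.single i (1 : ℝ)) = -(1 / (2 * r)) * AA (fun z : E n => z i) r g x := by
  simp [DA]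

/-- Laplacian of `PA r g` in terms of the gradient of `g`. -/
def LA (r : ℝ) (g' : E n → E n →L[ℝ] ℝ) (x : E n) : ℝ :=
  ∑ j : Fin n, DA r (fun y => g' y (EuclideanSpace.single j (1 : ℝ))) x (EuclideanSpace.single j (1 : ℝ))

lemma gk_hasFDerivAt (z : E n) :
    HasFDerivAt (gk n) ((-(1 / 2) * gk n z) • innerSL ℝ z) z := by
  have h1 : HasFDerivAt (fun z : E n => ‖z‖ ^ 2) (2 • (innerSL ℝ z)) z := by
    exact (hasStrictFDerivAt_norm_sq z).hasFDerivAt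
  have h2 := ((h1.const_mul (-(1/4) : ℝ)).exp).const_mul ((4 * π) ^ (-(n : ℝ) / 2))
  have h3 : gk n = fun z : E n => (4 * π) ^ (-(n : ℝ) / 2) * Real.exp (-(1/4) * ‖z‖ ^ 2) := by
    ext z; unfold gk; congr 2; ring
  have h4 : gk n z = (4 * π) ^ (-(n : ℝ) / 2) * Real.exp (-(1/4) * ‖z‖ ^ 2) := by rw [h3]
  rw [h4, h3]
  refine h2.congr_fderiv ?_
  ext v
  simp only [smul_apply, smul_eq_mul, nsmul_eq_mul, Nat.cast_ofNat]
  ring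

lemma innerSL_eq_sum (z : E n) : (innerSL ℝ z : E n →L[ℝ] ℝ) =
    ∑ j : Fin n, z j • (EuclideanSpace.proj j : E n →L[ℝ] ℝ) := by
  ext v
  simp [PiLp.inner_apply, mul_comm]

lemma PA_shift (r : ℝ) (hr : 0 < r) (g : E n → ℝ) (x h : E n) :
    PA r g (x + h) = ∫ z : E n, gk n (z + r⁻¹ • h) * g (x - r • z) := by
  unfold PA AA
  rw [← integral_add_right_eq_self _ (r⁻¹ • h)]
  congr 1; ext z
  have : x + h - r • (z + r⁻¹ • h) = x - r • z := by
    rw [smul_add, smul_smul, mul_inv_cancel₀ hr.ne', one_smul]; abel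
  rw [this]; simp

lemma PA_hasFDerivAt_kernel {a C r : ℝ} (hr : 0 < r) (ha : 0 ≤ a) (har : 32 * a * r ^ 2 ≤ 1) {g : E n → ℝ}
    (hgc : Continuous g) (hg : ∀ x, ‖g x‖ ≤ C * Real.exp (a * ‖x‖ ^ 2)) (x : E n) :
    HasFDerivAt (fun y => PA r g y) (DA r g x) x := by
  have hC : 0 ≤ C := by
    have := (norm_nonneg _).trans (hg 0)
    exact nonneg_of_mul_nonneg_left this (Real.exp_pos _)
  have har' : 16 * a * r ^ 2 ≤ 1 := by nlinarith [mul_nonneg ha (sq_nonneg r)]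
  have key : HasFDerivAt (fun h : E n => ∫ z : E n, gk n (z + r⁻¹ • h) * g (x - r • z))
      (∫ z : E n, (g (x - r • z)) • ((-(1 / 2) * gk n (z + r⁻¹ • (0 : E n))) • r⁻¹ • innerSL ℝ (z + r⁻¹ • (0 : E n)))) 0 := by
    refine hasFDerivAt_integral_of_dominated_of_fderiv_le (𝕜 := ℝ)
      (F' := fun h z => (g (x - r • z)) • ((-(1 / 2) * gk n (z + r⁻¹ • h)) • r⁻¹ • innerSL ℝ (z + r⁻¹ • h)))
      (bound := fun z => (C * Real.exp (2 * a * ‖x‖ ^ 2) * r⁻¹ * Real.exp (1/4) * ((4 * π) ^ (-(n : ℝ) / 2) * 32)) *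
        Real.exp (-(1/ 16 / 2) * ‖z‖ ^ 2))
      (ball_mem_nhds (0 : E n) hr) ?_ ?_ ?_ ?_ ?_ ?_
    · refine Filter.Eventually.of_forall fun h => ?_
      have := gk_cont (n := n)
      apply Continuous.aestronglyMeasurable; fun_prop
    · have := AA_integrable continuous_const one_bd ha har' hgc hg x
      simpa using this
    · have := gk_cont (n := n)
      apply Continuous.aestronglyMeasurable; fun_prop
    · refine Filter.Eventually.of_forall fun z h hh => ?_
      have hh1 : ‖r⁻¹ • h‖ ≤ 1 := by
        rw [norm_smul, Real.norm_of_nonneg (by positivity), inv_mul_le_iff₀ hr, mul_one]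
        exact (mem_ball_zero_iff.1 hh).le
      set v := r⁻¹ • h with hv
      have hz : ‖z‖ ^ 2 ≤ 2 * ‖z + v‖ ^ 2 + 2 := by
        have : ‖z‖ ≤ ‖z + v‖ + 1 := by
          calc ‖z‖ = ‖(z + v) - v‖ := by simp
            _ ≤ ‖z + v‖ + ‖v‖ := norm_sub_le _ _
            _ ≤ _ := by gcongr
        nlinarith [sq_nonneg (‖z + v‖ - 1), norm_nonneg z]
      rw [norm_smul, norm_smul, norm_smul, innerSL_apply_norm, norm_mul, Real.norm_of_nonneg (gk_pos _).le,
        Real.norm_of_nonneg (inv_pos.2 hr).le]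
      have e1 : ‖(-(1/2) : ℝ)‖ = 1/2 := by norm_num
      rw [e1]
      have hgk : gk n (z + v) * ‖z + v‖ ≤ ((4 * π) ^ (-(n : ℝ) / 2) * 32) * Real.exp (-(3/16) * ‖z + v‖ ^ 2) := by
        have h1 : ‖z + v‖ ≤ 32 * Real.exp (‖z + v‖ ^ 2 / 16) := by
          have := Real.add_one_le_exp (‖z + v‖ ^ 2 / 16)
          nlinarith [sq_nonneg (1 - ‖z + v‖), norm_nonneg (z + v)]
        have h2 : Real.exp (-(3/16) * ‖z + v‖ ^ 2) = Real.exp (-‖z + v‖ ^ 2 / 4) * Real.exp (‖z + v‖ ^ 2 / 16) := by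
          rw [← Real.exp_add]; congr 1; ring
        rw [h2]; unfold gk
        calc _ ≤ (4 * π) ^ (-(n : ℝ) / 2) * Real.exp (-‖z + v‖ ^ 2 / 4) * (32 * Real.exp (‖z + v‖ ^ 2 / 16)) := by
              gcongr
          _ = _ := by ring
      have hga : ‖g (x - r • z)‖ ≤ C * (Real.exp (2 * a * ‖x‖ ^ 2) * Real.exp (‖z‖ ^ 2 / 16)) := by
        refine (hg _).trans ?_
        gcongr
        rw [← Real.exp_add]
        apply Real.exp_le_exp.2
        have := mul_le_mul_of_nonneg_left (norm_sub_sq_le x z r) ha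
        nlinarith [mul_le_mul_of_nonneg_right har (sq_nonneg ‖z‖)]
      have hexp : Real.exp (-(3/16) * ‖z + v‖ ^ 2) * Real.exp (‖z‖ ^ 2 / 16) ≤
          Real.exp (1/4) * Real.exp (-(1/16/2) * ‖z‖ ^ 2) := by
        rw [← Real.exp_add, ← Real.exp_add]
        apply Real.exp_le_exp.2
        nlinarith
      have hK : 0 < (4 * π) ^ (-(n : ℝ) / 2) := by positivity
      calc _ = (1/2) * r⁻¹ * (‖g (x - r • z)‖ * (gk n (z + v) * ‖z + v‖)) := by ring
        _ ≤ 1 * r⁻¹ * ((C * (Real.exp (2 * a * ‖x‖ ^ 2) * Real.exp (‖z‖ ^ 2 / 16))) *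
            (((4 * π) ^ (-(n : ℝ) / 2) * 32) * Real.exp (-(3/16) * ‖z + v‖ ^ 2))) := by
            have hpp := gk_pos (z + v)
            have h12 : (1/2 : ℝ) ≤ 1 := by norm_num
            gcongr
        _ = (C * Real.exp (2 * a * ‖x‖ ^ 2) * r⁻¹ * ((4 * π) ^ (-(n : ℝ) / 2) * 32)) *
            (Real.exp (-(3/16) * ‖z + v‖ ^ 2) * Real.exp (‖z‖ ^ 2 / 16)) := by ring
        _ ≤ (C * Real.exp (2 * a * ‖x‖ ^ 2) * r⁻¹ * ((4 * π) ^ (-(n : ℝ) / 2) * 32)) *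
            (Real.exp (1/4) * Real.exp (-(1/16/2) * ‖z‖ ^ 2)) := by gcongr
        _ = _ := by ring
    · exact (integrable_gauss (by norm_num)).const_mul _
    · refine Filter.Eventually.of_forall fun z h _ => ?_
      have h1 : HasFDerivAt (fun h : E n => z + r⁻¹ • h) (r⁻¹ • ContinuousLinearMap.id ℝ (E n)) h :=
        ((hasFDerivAt_id h).const_smul r⁻¹).const_add z
      have h2 := ((gk_hasFDerivAt (z + r⁻¹ • h)).comp h h1).mul_const (g (x - r • z))
      refine h2.congr_fderiv ?_
      ext w
      simp only [smul_apply, ContinuousLinearMap.comp_apply, smul_eq_mul, map_smul,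
        ContinuousLinearMap.id_apply]
      ring
  have key2 : HasFDerivAt (fun h : E n => PA r g (x + h)) (DA r g x) 0 := by
    have e1 : (fun h : E n => PA r g (x + h)) = (fun h : E n => ∫ z : E n, gk n (z + r⁻¹ • h) * g (x - r • z)) := by
      ext h; exact PA_shift r hr g x h
    rw [e1]
    refine key.congr_fderiv (Eq.symm ?_)
    unfold DA AA
    have e2 : ∀ z : E n, (g (x - r • z)) • ((-(1 / 2) * gk n (z + r⁻¹ • (0 : E n))) • r⁻¹ • innerSL ℝ (z + r⁻¹ • (0 : E n)))
        = (-(1/(2 * r))) • ∑ j : Fin n, ((gk n z * z j) • g (x - r • z)) • (EuclideanSpace.proj j : E n →L[ℝ] ℝ) := by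
      intro z
      simp only [smul_zero, add_zero]
      rw [innerSL_eq_sum]
      simp only [Finset.smul_sum, smul_smul, smul_eq_mul]
      congr 1; ext1 j
      congr 1; field_simp
    simp_rw [e2]
    rw [integral_smul, integral_finsetSum]
    · congr 1; congr 1; ext1 j
      rw [integral_smul_const]
    · intro j _
      exact (AA_integrable (coord_cont j) (coord_bd j) ha har' hgc hg x).smul_const _
  have key3 := HasFDerivAt.comp (g := fun h : E n => PA r g (x + h)) (f := fun y : E n => y - x) x
    (by simpa using key2) ((hasFDerivAt_id x).sub_const x)
  simpa [Function.comp_def] using key3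

lemma PA_hasFDerivAt {a C C' r : ℝ} (ha : 0 ≤ a) (har : 16 * a * r ^ 2 ≤ 1) {g : E n → ℝ}
    {g' : E n → E n →L[ℝ] ℝ} (hgd : ∀ x, HasFDerivAt g (g' x) x) (hgc' : Continuous g')
    (hg : ∀ x, ‖g x‖ ≤ C * Real.exp (a * ‖x‖ ^ 2)) (hg' : ∀ x, ‖g' x‖ ≤ C' * Real.exp (a * ‖x‖ ^ 2)) (x : E n) :
    HasFDerivAt (fun y => PA r g y) (PA r g' x) x := by
  have hC : 0 ≤ C' := by
    have := (norm_nonneg _).trans (hg' 0)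
    exact nonneg_of_mul_nonneg_left this (Real.exp_pos _)
  have hgc : Continuous g := continuous_iff_continuousAt.2 fun x => (hgd x).continuousAt
  unfold PA AA
  refine hasFDerivAt_integral_of_dominated_of_fderiv_le (𝕜 := ℝ)
      (F' := fun y z => (gk n z * 1) • g' (y - r • z))
      (bound := fun z => (C' * Real.exp (2 * a * (‖x‖ + 1) ^ 2)) * wk n z)
      (ball_mem_nhds x one_pos) ?_ ?_ ?_ ?_ ?_ ?_
  · exact Filter.Eventually.of_forall fun y => AA_meas continuous_const hgc r y
  · exact AA_integrable continuous_const one_bd ha har hgc hg x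
  · exact AA_meas continuous_const hgc' r x
  · refine Filter.Eventually.of_forall fun z y hy => ?_
    refine (AA_ptbound (m := fun _ => 1) one_bd ha har hg' y z).trans ?_
    have := wk_pos z
    have h2 : ‖y‖ ≤ ‖x‖ + 1 := by
      have := mem_ball_iff_norm.1 hy
      calc ‖y‖ = ‖x + (y - x)‖ := by congr 1; abel
        _ ≤ ‖x‖ + ‖y - x‖ := norm_add_le _ _
        _ ≤ _ := by gcongr
    gcongr
  · exact wk_integrable.const_mul _
  · refine Filter.Eventually.of_forall fun z y _ => ?_
    have h1 : HasFDerivAt (fun y : E n => y - r • z) (ContinuousLinearMap.id ℝ (E n)) y :=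
      (hasFDerivAt_id y).sub_const _
    have h2 := ((hgd (y - r • z)).comp y h1).const_smul (gk n z * 1)
    exact h2.congr_fderiv (by ext w; simp)

lemma clm_eq_sum (L : E n →L[ℝ] ℝ) (z : E n) : L z = ∑ j : Fin n, z j * L (EuclideanSpace.single j (1 : ℝ)) := by
  have h : z = ∑ j : Fin n, z j • EuclideanSpace.single j (1 : ℝ) := by
    ext i
    simp [Finset.sum_apply, Pi.single_apply]
  conv_lhs => rw [h]
  simp

lemma single_norm (j : Fin n) : ‖EuclideanSpace.single j (1 : ℝ)‖ = 1 := by simp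

lemma clm_single_bd (L : E n →L[ℝ] ℝ) (j : Fin n) : ‖L (EuclideanSpace.single j (1 : ℝ))‖ ≤ ‖L‖ := by
  simpa using L.le_opNorm (EuclideanSpace.single j (1 : ℝ))

lemma PA_hasDerivAt_scale {a C C' r : ℝ} (ha : 0 ≤ a) (har : 16 * a * r ^ 2 < 1) {g : E n → ℝ}
    {g' : E n → E n →L[ℝ] ℝ} (hgd : ∀ x, HasFDerivAt g (g' x) x) (hgc' : Continuous g')
    (hg : ∀ x, ‖g x‖ ≤ C * Real.exp (a * ‖x‖ ^ 2)) (hg' : ∀ x, ‖g' x‖ ≤ C' * Real.exp (a * ‖x‖ ^ 2)) (x : E n) :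
    HasDerivAt (fun r => PA r g x)
      (-∑ j : Fin n, AA (fun z : E n => z j) r (fun y => g' y (EuclideanSpace.single j (1 : ℝ))) x) r := by
  have hgc : Continuous g := continuous_iff_continuousAt.2 fun x => (hgd x).continuousAt
  have hs : {r : ℝ | 16 * a * r ^ 2 < 1} ∈ 𝓝 r := by
    have ho : IsOpen {r : ℝ | 16 * a * r ^ 2 < 1} := isOpen_lt (by fun_prop) (by fun_prop)
    exact ho.mem_nhds har
  have key := hasDerivAt_integral_of_dominated_loc_of_deriv_le (𝕜 := ℝ) (μ := (volume : Measure (E n)))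
      (F := fun r z => (gk n z * 1) • g (x - r • z))
      (F' := fun r z => (gk n z) • g' (x - r • z) (-z))
      (bound := fun z => (C' * Real.exp (2 * a * (‖x‖) ^ 2)) * wk n z) hs
      (Filter.Eventually.of_forall fun y => AA_meas continuous_const hgc y x)
      (AA_integrable continuous_const one_bd ha har.le hgc hg x) ?_ ?_ (wk_integrable.const_mul _) ?_
  · refine key.2.congr_deriv (Eq.symm ?_)
    unfold AA
    rw [← integral_finsetSum, ← integral_neg]
    · congr 1; ext z
      rw [map_neg, clm_eq_sum (g' (x - r • z)) z, smul_eq_mul, mul_neg, Finset.mul_sum]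
      congr 1; apply Finset.sum_congr rfl; intro j _
      rw [smul_eq_mul]; ring
    · intro j _
      exact AA_integrable (coord_cont j) (coord_bd j) ha har.le (by fun_prop)
        (fun x => (clm_single_bd _ j).trans (hg' x)) x
  · have := gk_cont (n := n)
    apply Continuous.aestronglyMeasurable
    fun_prop
  · refine Filter.Eventually.of_forall fun z s hs => ?_
    have h1 := AA_ptbound (m := fun z : E n => ‖z‖) (fun z => by
      rw [abs_of_nonneg (norm_nonneg z)]; nlinarith [norm_nonneg z]) ha (le_of_lt hs) hg' x z
    refine le_trans ?_ h1
    rw [norm_smul, norm_smul, norm_mul, norm_norm, mul_assoc]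
    gcongr
    rw [mul_comm]
    simpa using (g' (x - s • z)).le_opNorm (-z)
  · refine Filter.Eventually.of_forall fun z s _ => ?_
    have h1 : HasDerivAt (fun s : ℝ => x - s • z) (-z) s := by
      have := ((hasDerivAt_id s).smul_const z).const_sub x
      simpa using this
    have h2 := ((hgd (x - s • z)).comp_hasDerivAt s h1).const_smul (gk n z * 1)
    exact h2.congr_deriv (by simp)

lemma PA_hasDerivAt_time {a C C' t : ℝ} (ha : 0 ≤ a) (ht : 0 < t) (hat : 16 * a * t < 1) {g : E n → ℝ}
    {g' : E n → E n →L[ℝ] ℝ} (hgd : ∀ x, HasFDerivAt g (g' x) x) (hgc' : Continuous g')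
    (hg : ∀ x, ‖g x‖ ≤ C * Real.exp (a * ‖x‖ ^ 2)) (hg' : ∀ x, ‖g' x‖ ≤ C' * Real.exp (a * ‖x‖ ^ 2)) (x : E n) :
    HasDerivAt (fun t => PA (√t) g x) (LA (√t) g' x) t := by
  have h1 := PA_hasDerivAt_scale (r := √t) ha (by rwa [Real.sq_sqrt ht.le]) hgd hgc' hg hg' x
  have h2 := h1.comp t (Real.hasDerivAt_sqrt ht.ne')
  refine h2.congr_deriv ?_
  unfold LA
  simp_rw [DA_apply]
  rw [← Finset.mul_sum]; ring

/-! Conversion to the heat kernel. -/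

lemma heatKernel_conv {t : ℝ} (ht : 0 < t) (g : E n → ℝ) (x : E n) :
    ∫ y : E n, heatKernel n t (x - y) * g y = PA (√t) g x := by
  have h1 : ∫ y : E n, heatKernel n t (x - y) * g y = ∫ w : E n, heatKernel n t w * g (x - w) := by
    rw [← integral_sub_left_eq_self _ _ x]
    simp
  have h2 := Measure.integral_comp_smul (volume : Measure (E n)) (fun w => heatKernel n t w * g (x - w)) (√t)
  have hst : 0 < √t := Real.sqrt_pos.2 ht
  rw [finrank_euclideanSpace, Fintype.card_fin, abs_of_pos (by positivity), smul_eq_mul] at h2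
  rw [h1]
  have h3 : ∫ w : E n, heatKernel n t w * g (x - w) = (√t) ^ n * ∫ z : E n, heatKernel n t (√t • z) * g (x - √t • z) := by
    rw [h2]; field_simp
  rw [h3, ← integral_const_mul]
  unfold PA AA
  congr 1; ext z
  unfold heatKernel gk
  rw [norm_smul, Real.norm_of_nonneg hst.le, mul_pow, Real.sq_sqrt ht.le, Real.mul_rpow (by positivity) ht.le]
  have e1 : -(t * ‖z‖ ^ 2) / (4 * t) = -‖z‖ ^ 2 / 4 := by field_simp
  have e2 : (√t) ^ n * t ^ (-(n : ℝ) / 2) = 1 := by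
    rw [Real.sqrt_eq_rpow, ← Real.rpow_natCast, ← Real.rpow_mul ht.le, ← Real.rpow_add ht]
    convert Real.rpow_zero t using 2; ring
  rw [e1, smul_eq_mul]
  linear_combination ((4 * π) ^ (-(n : ℝ) / 2) * Real.exp (-‖z‖ ^ 2 / 4) * g (x - √t • z)) * e2

lemma heatKernel_semi {s t : ℝ} (hs : 0 < s) (ht : 0 < t) (x w : E n) :
    ∫ y : E n, heatKernel n s (x - y) * heatKernel n t (y - w) = heatKernel n (s + t) (x - w) := by
  set c : ℝ := (s + t) / (4 * s * t) with hc
  have hcpos : 0 < c := by positivity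
  set m : E n := (t / (s + t)) • x + (s / (s + t)) • w with hm
  have key : ∀ y : E n, heatKernel n s (x - y) * heatKernel n t (y - w) =
      ((4 * π * s) ^ (-(n : ℝ) / 2) * (4 * π * t) ^ (-(n : ℝ) / 2) *
        Real.exp (-‖x - w‖ ^ 2 / (4 * (s + t)))) * Real.exp (-c * ‖y - m‖ ^ 2) := by
    intro y
    unfold heatKernel
    have e : Real.exp (-‖x - y‖ ^ 2 / (4 * s)) * Real.exp (-‖y - w‖ ^ 2 / (4 * t)) =
        Real.exp (-‖x - w‖ ^ 2 / (4 * (s + t))) * Real.exp (-c * ‖y - m‖ ^ 2) := by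
      rw [← Real.exp_add, ← Real.exp_add]
      congr 1
      have e1 : x - w = (x - y) + (y - w) := by abel
      have e2 : y - m = (s / (s + t)) • (y - w) - (t / (s + t)) • (x - y) := by
        have : y = (s / (s + t)) • y + (t / (s + t)) • y := by
          rw [← add_smul, ← add_div, div_self (by positivity), one_smul]
        rw [hm]; nth_rw 1 [this]
        rw [smul_sub, smul_sub]; abel
      rw [e1, e2]
      generalize x - y = p
      generalize y - w = q
      rw [norm_add_sq_real, norm_sub_sq_real, norm_smul, norm_smul, inner_smul_left, inner_smul_right,
        Real.norm_of_nonneg (by positivity), Real.norm_of_nonneg (by positivity), real_inner_comm]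
      simp only [conj_trivial]
      rw [hc]
      field_simp
      ring
    linear_combination ((4 * π * s) ^ (-(n : ℝ) / 2) * (4 * π * t) ^ (-(n : ℝ) / 2)) * e
  simp_rw [key]
  rw [integral_const_mul, integral_sub_right_eq_self (fun y : E n => Real.exp (-c * ‖y‖ ^ 2)) m,
    GaussianFourier.integral_rexp_neg_mul_sq_norm hcpos, finrank_euclideanSpace, Fintype.card_fin]
  unfold heatKernel
  have e : (4 * π * s) ^ (-(n : ℝ) / 2) * (4 * π * t) ^ (-(n : ℝ) / 2) * (π / c) ^ ((n : ℝ) / 2) =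
      (4 * π * (s + t)) ^ (-(n : ℝ) / 2) := by
    have : π / c = (4 * π * s) * (4 * π * t) / (4 * π * (s + t)) := by
      rw [hc]; field_simp
    have hs4 : 0 ≤ 4 * π * s := by positivity
    have ht4 : 0 ≤ 4 * π * t := by positivity
    have hst4 : 0 ≤ 4 * π * (s + t) := by positivity
    rw [this, Real.div_rpow (mul_nonneg hs4 ht4) hst4, Real.mul_rpow hs4 ht4,
      neg_div, Real.rpow_neg hs4, Real.rpow_neg ht4, Real.rpow_neg hst4]
    have hA : (4 * π * s) ^ ((n : ℝ) / 2) ≠ 0 := by positivity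
    have hB : (4 * π * t) ^ ((n : ℝ) / 2) ≠ 0 := by positivity
    have hD : (4 * π * (s + t)) ^ ((n : ℝ) / 2) ≠ 0 := by positivity
    generalize (4 * π * s) ^ ((n : ℝ) / 2) = A at *
    generalize (4 * π * t) ^ ((n : ℝ) / 2) = B at *
    generalize (4 * π * (s + t)) ^ ((n : ℝ) / 2) = D at *
    field_simp
  rw [← e]; ring

lemma heatKernel_nonneg {t : ℝ} (ht : 0 < t) (z : E n) : 0 ≤ heatKernel n t z := by
  unfold heatKernel; positivity

lemma heatKernel_cont {t : ℝ} : Continuous (heatKernel n t) := by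
  unfold heatKernel; fun_prop

lemma heatKernel_integrable {a C t : ℝ} (ht : 0 < t) (ha : 0 ≤ a) (hat : 16 * a * t ≤ 1) {g : E n → ℝ}
    (hgc : Continuous g) (hg : ∀ x, ‖g x‖ ≤ C * Real.exp (a * ‖x‖ ^ 2)) (x : E n) :
    Integrable (fun y : E n => heatKernel n t (x - y) * g y) := by
  by_cases hz : ∀ y, g y = 0
  · simp [hz]
  have hst : 0 < √t := Real.sqrt_pos.2 ht
  have hK : (4 * π * t) ^ (-(n : ℝ) / 2) ≠ 0 := by positivity
  have h1 := AA_integrable (m := fun _ => (1:ℝ)) continuous_const one_bd ha (r := √t)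
    (by rwa [Real.sq_sqrt ht.le]) hgc hg x
  have h2 : Integrable (fun z : E n => heatKernel n t (√t • z) * g (x - √t • z)) := by
    refine (h1.const_mul (t ^ (-(n : ℝ) / 2))).congr (Filter.Eventually.of_forall fun z => ?_)
    simp only [heatKernel, gk]
    rw [norm_smul, Real.norm_of_nonneg hst.le, mul_pow, Real.sq_sqrt ht.le, Real.mul_rpow (by positivity) ht.le]
    have e1 : -(t * ‖z‖ ^ 2) / (4 * t) = -‖z‖ ^ 2 / 4 := by field_simp
    rw [e1, smul_eq_mul]; ring
  have h3 := (integrable_comp_smul_iff (volume : Measure (E n)) (fun w => heatKernel n t w * g (x - w)) hst.ne').1 h2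
  have h4 := h3.comp_sub_left x
  simpa using h4

lemma PA_semi {a C s t : ℝ} (hs : 0 < s) (ht : 0 < t) (ha : 0 ≤ a) (has : 32 * a * s ≤ 1)
    (hat : 16 * a * t ≤ 1) {g : E n → ℝ}
    (hgc : Continuous g) (hg : ∀ x, ‖g x‖ ≤ C * Real.exp (a * ‖x‖ ^ 2)) (x : E n) :
    PA (√s) (fun y => PA (√t) g y) x = PA (√(s + t)) g x := by
  rw [← heatKernel_conv hs, ← heatKernel_conv (by positivity)]
  simp_rw [← heatKernel_conv ht]
  have hat' : 16 * a * (√t) ^ 2 ≤ 1 := by rwa [Real.sq_sqrt ht.le]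
  have e1 : ∀ y, heatKernel n s (x - y) * ∫ w, heatKernel n t (y - w) * g w =
      ∫ w, heatKernel n s (x - y) * (heatKernel n t (y - w) * g w) := fun y => by rw [integral_const_mul]
  simp_rw [e1]
  have hgn : Continuous (fun y => ‖g y‖) := hgc.norm
  have hgn2 : ∀ x, ‖‖g x‖‖ ≤ C * Real.exp (a * ‖x‖ ^ 2) := by simpa using hg
  rw [integral_integral_swap]
  · congr 1; ext w
    rw [← heatKernel_semi hs ht, ← integral_mul_const]
    congr 1; ext y; ring
  · have hk := heatKernel_cont (n := n) (t := s)
    have hk2 := heatKernel_cont (n := n) (t := t)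
    rw [integrable_prod_iff (by apply Continuous.aestronglyMeasurable; unfold Function.uncurry; fun_prop)]
    constructor
    · refine Filter.Eventually.of_forall fun y => ?_
      have hi := (heatKernel_integrable ht ha hat hgc hg y).const_mul (heatKernel n s (x - y))
      exact hi
    · have e2 : ∀ y : E n, ∫ w, ‖Function.uncurry (fun y w => heatKernel n s (x - y) * (heatKernel n t (y - w) * g w)) (y, w)‖
          = heatKernel n s (x - y) * PA (√t) (fun w => ‖g w‖) y := by
        intro y
        rw [← heatKernel_conv ht, ← integral_const_mul]
        congr 1; ext w
        simp only [Function.uncurry, norm_mul]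
        rw [Real.norm_of_nonneg (heatKernel_nonneg hs _), Real.norm_of_nonneg (heatKernel_nonneg ht _)]
      simp_rw [e2]
      refine heatKernel_integrable (a := 2 * a) (C := KK n * C) hs (by positivity) (by linarith) ?_ ?_ x
      · have h := AA_cont (n := n) (m := fun _ => (1:ℝ)) continuous_const one_bd ha (I := univ) (f := fun y _ => ‖g y‖)
          (by fun_prop) (fun x _ _ => hgn2 x)
        rw [← continuousOn_univ]
        exact h.comp (f := fun y : E n => (y, √t, (0 : ℝ))) (by fun_prop) (fun y _ => ⟨mem_univ _, hat', mem_univ _⟩)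
      · intro y
        exact AA_norm_le one_bd ha hat' hgn2 y

lemma PA_continuous {F : Type*} [NormedAddCommGroup F] [NormedSpace ℝ F]
    {a C r : ℝ} (ha : 0 ≤ a) (har : 16 * a * r ^ 2 ≤ 1) {g : E n → F}
    (hgc : Continuous g) (hg : ∀ x, ‖g x‖ ≤ C * Real.exp (a * ‖x‖ ^ 2)) :
    Continuous (fun x => PA r g x) := by
  have h := AA_cont (n := n) (m := fun _ => (1:ℝ)) continuous_const one_bd ha (I := univ) (f := fun y _ => g y)
    (by fun_prop) (fun x _ _ => hg x)
  rw [← continuousOn_univ]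
  exact h.comp (f := fun y : E n => (y, r, (0 : ℝ))) (by fun_prop) (fun y _ => ⟨mem_univ _, har, mem_univ _⟩)

end gauss2

section nn
variable {n : ℕ} {F : Type*} [NormedAddCommGroup F] [NormedSpace ℝ F]

/-- Duhamel type integral. -/
def NN (J : E n → ℝ → ℝ → F) (x : E n) (t : ℝ) : F := ∫ τ in Ioo (0 : ℝ) t, J x τ (t - τ)

/-- admissible integrands -/
structure NAdm (T C b : ℝ) (q : ℝ → ℝ) (J : E n → ℝ → ℝ → F) : Prop where
  cont : ContinuousOn (fun p : E n × ℝ × ℝ => J p.1 p.2.1 p.2.2) (univ ×ˢ (Ioo 0 T ×ˢ Ioo 0 T))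
  bd : ∀ x, ∀ τ ∈ Ioo 0 T, ∀ s ∈ Ioo 0 T, ‖J x τ s‖ ≤ C * Real.exp (b * ‖x‖ ^ 2) * q τ

lemma sqrt_inv_integrable (T : ℝ) : IntegrableOn (fun τ : ℝ => (√τ)⁻¹) (Ioo 0 T) := by
  rcases le_or_gt T 0 with h | h
  · simp [Ioo_eq_empty (not_lt.2 h)]
  have h1 := (intervalIntegral.intervalIntegrable_rpow' (a := 0) (b := T) (r := -(1/2)) (by norm_num))
  rw [intervalIntegrable_iff_integrableOn_Ioo_of_le h.le] at h1
  refine h1.congr_fun (fun τ hτ => ?_) measurableSet_Ioo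
  simp only
  rw [Real.rpow_neg hτ.1.le, ← Real.sqrt_eq_rpow]

lemma one_integrable (T : ℝ) : IntegrableOn (fun _ : ℝ => (1 : ℝ)) (Ioo 0 T) := by
  simp

variable {T C b : ℝ} {q : ℝ → ℝ} {J : E n → ℝ → ℝ → F}

lemma NAdm.contSlice (h : NAdm T C b q J) {t : ℝ} (ht : t ≤ T) (x : E n) :
    ContinuousOn (fun τ => J x τ (t - τ)) (Ioo 0 t) := by
  refine h.cont.comp (f := fun τ : ℝ => (x, τ, t - τ)) (by fun_prop) (fun τ hτ => ?_)
  exact ⟨mem_univ _, ⟨hτ.1, hτ.2.trans_le ht⟩, ⟨by simpa using hτ.2, by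
    have := hτ.1; simp only; linarith⟩⟩

lemma NAdm.meas (h : NAdm T C b q J) {t : ℝ} (ht : t ≤ T) (x : E n) :
    AEStronglyMeasurable (fun τ => J x τ (t - τ)) (volume.restrict (Ioo 0 t)) :=
  (h.contSlice ht x).aestronglyMeasurable measurableSet_Ioo

lemma NAdm.bdSlice (h : NAdm T C b q J) {t : ℝ} (ht : t ≤ T) (x : E n) {τ : ℝ} (hτ : τ ∈ Ioo 0 t) :
    ‖J x τ (t - τ)‖ ≤ C * Real.exp (b * ‖x‖ ^ 2) * q τ :=
  h.bd x τ ⟨hτ.1, hτ.2.trans_le ht⟩ _ ⟨by linarith [hτ.2], by linarith [hτ.1]⟩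

lemma NAdm.integrableOn (h : NAdm T C b q J) (hq : IntegrableOn q (Ioo 0 T)) {t : ℝ} (ht : t ≤ T) (x : E n) :
    IntegrableOn (fun τ => J x τ (t - τ)) (Ioo 0 t) := by
  refine Integrable.mono' (((hq.mono_set (Ioo_subset_Ioo_right ht)).const_mul
    (C * Real.exp (b * ‖x‖ ^ 2)))) (h.meas ht x) ?_
  refine (ae_restrict_iff' measurableSet_Ioo).2 (Eventually.of_forall fun τ hτ => ?_)
  exact h.bdSlice ht x hτ

lemma NAdm.norm_le (h : NAdm T C b q J) (hq : IntegrableOn q (Ioo 0 T))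
    (hq0 : ∀ τ ∈ Ioo 0 T, 0 ≤ q τ) (hC : 0 ≤ C) {t : ℝ} (ht : t ≤ T) (x : E n) :
    ‖NN J x t‖ ≤ (C * ∫ τ in Ioo 0 T, q τ) * Real.exp (b * ‖x‖ ^ 2) := by
  have h1 : ‖NN J x t‖ ≤ ∫ τ in Ioo 0 t, C * Real.exp (b * ‖x‖ ^ 2) * q τ := by
    refine norm_integral_le_of_norm_le ((hq.mono_set (Ioo_subset_Ioo_right ht)).const_mul _) ?_
    refine (ae_restrict_iff' measurableSet_Ioo).2 (Eventually.of_forall fun τ hτ => ?_)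
    exact h.bdSlice ht x hτ
  rw [integral_const_mul] at h1
  have h2 : ∫ τ in Ioo 0 t, q τ ≤ ∫ τ in Ioo 0 T, q τ := by
    refine setIntegral_mono_set hq ?_ (Ioo_subset_Ioo_right ht).eventuallyLE
    exact (ae_restrict_iff' measurableSet_Ioo).2 (Eventually.of_forall hq0)
  refine h1.trans ?_
  calc _ ≤ C * Real.exp (b * ‖x‖ ^ 2) * ∫ τ in Ioo 0 T, q τ := by gcongr
    _ = _ := by ring

lemma NN_eq_indicator (J : E n → ℝ → ℝ → F) {t : ℝ} (ht : t ≤ T) (x : E n) :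
    NN J x t = ∫ τ in Ioo 0 T, (Iio t).indicator (fun τ => J x τ (t - τ)) τ := by
  unfold NN
  rw [setIntegral_indicator measurableSet_Iio]
  congr 2
  ext τ; simp only [mem_Ioo, mem_inter_iff, mem_Iio]
  constructor
  · rintro ⟨h1, h2⟩; exact ⟨⟨h1, h2.trans_le ht⟩, h2⟩
  · rintro ⟨⟨h1, _⟩, h2⟩; exact ⟨h1, h2⟩

lemma NAdm.continuousOn (h : NAdm T C b q J) (hq : IntegrableOn q (Ioo 0 T))
    (hq0 : ∀ τ ∈ Ioo 0 T, 0 ≤ q τ) (hC : 0 ≤ C) (hb : 0 ≤ b) :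
    ContinuousOn (fun p : E n × ℝ => NN J p.1 p.2) (univ ×ˢ Iic T) := by
  have hS : MeasurableSet (Ioo 0 T) := measurableSet_Ioo
  have e : EqOn (fun p : E n × ℝ => NN J p.1 p.2)
      (fun p => ∫ τ in Ioo 0 T, (Iio p.2).indicator (fun τ => J p.1 τ (p.2 - τ)) τ) (univ ×ˢ Iic T) := by
    intro p hp; exact NN_eq_indicator J hp.2 p.1
  refine ContinuousOn.congr ?_ e
  intro p₀ hp₀
  refine continuousWithinAt_of_dominated
    (bound := fun τ => C * Real.exp (b * (‖p₀.1‖ + 1) ^ 2) * q τ) ?_ ?_ ?_ ?_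
  · refine eventually_nhdsWithin_of_forall fun p hp => ?_
    rw [aestronglyMeasurable_indicator_iff measurableSet_Iio, Measure.restrict_restrict measurableSet_Iio]
    have e : Iio p.2 ∩ Ioo 0 T = Ioo 0 p.2 := by
      have h2 : p.2 ≤ T := hp.2
      ext τ; simp only [mem_Ioo, mem_inter_iff, mem_Iio]
      constructor
      · rintro ⟨h1, h2, _⟩; exact ⟨h2, h1⟩
      · rintro ⟨h1, h3⟩; exact ⟨h3, h1, h3.trans_le h2⟩
    rw [e]
    exact h.meas hp.2 p.1
  · have hev : ∀ᶠ p : E n × ℝ in 𝓝 p₀, ‖p.1‖ < ‖p₀.1‖ + 1 :=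
      (continuous_fst.norm.continuousAt (x := p₀)).eventually_lt continuousAt_const (by simp)
    filter_upwards [nhdsWithin_le_nhds hev, self_mem_nhdsWithin] with p hp hpm
    refine (ae_restrict_iff' hS).2 (Eventually.of_forall fun τ hτ => ?_)
    have hq1 := hq0 τ hτ
    by_cases hlt : τ < p.2
    · rw [indicator_of_mem (show τ ∈ Iio p.2 from hlt)]
      refine (h.bdSlice hpm.2 p.1 ⟨hτ.1, hlt⟩).trans ?_
      gcongr
    · rw [indicator_of_notMem (show τ ∉ Iio p.2 from hlt), norm_zero]
      positivity
  · exact hq.const_mul _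
  · refine (ae_restrict_iff' hS).2 ?_
    have : ∀ᵐ τ : ℝ, τ ≠ p₀.2 := by
      rw [ae_iff]; simp
    filter_upwards [this] with τ hne hτ
    rcases lt_or_gt_of_ne hne with hlt | hgt
    · have hev : ∀ᶠ p : E n × ℝ in 𝓝[univ ×ˢ Iic T] p₀, J p.1 τ (p.2 - τ) = (Iio p.2).indicator (fun τ => J p.1 τ (p.2 - τ)) τ := by
        have : ∀ᶠ p : E n × ℝ in 𝓝 p₀, τ < p.2 :=
          continuousAt_const.eventually_lt (continuous_snd.continuousAt) hlt
        filter_upwards [nhdsWithin_le_nhds this] with p hp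
        rw [indicator_of_mem (show τ ∈ Iio p.2 from hp)]
      have hJ : ContinuousAt (fun p : E n × ℝ × ℝ => J p.1 p.2.1 p.2.2) (p₀.1, τ, p₀.2 - τ) := by
        refine h.cont.continuousAt (IsOpen.mem_nhds (isOpen_univ.prod (isOpen_Ioo.prod isOpen_Ioo)) ?_)
        have h2 : p₀.2 ≤ T := hp₀.2
        exact ⟨mem_univ _, hτ, ⟨by simpa using hlt, by have := hτ.1; simp only; linarith⟩⟩
      have hJ2 : ContinuousAt (fun p : E n × ℝ => J p.1 τ (p.2 - τ)) p₀ :=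
        ContinuousAt.comp (f := fun p : E n × ℝ => (p.1, τ, p.2 - τ)) (x := p₀) hJ (by fun_prop)
      refine (hJ2.continuousWithinAt).congr_of_eventuallyEq (hev.mono fun p hp => hp.symm) ?_
      rw [indicator_of_mem (show τ ∈ Iio p₀.2 from hlt)]
    · have hev : ∀ᶠ p : E n × ℝ in 𝓝[univ ×ˢ Iic T] p₀, (Iio p.2).indicator (fun τ => J p.1 τ (p.2 - τ)) τ = 0 := by
        have : ∀ᶠ p : E n × ℝ in 𝓝 p₀, p.2 < τ :=
          (continuous_snd.continuousAt).eventually_lt continuousAt_const hgt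
        filter_upwards [nhdsWithin_le_nhds this] with p hp
        rw [indicator_of_notMem (show τ ∉ Iio p.2 from not_lt.2 hp.le)]
      refine (continuousWithinAt_const (b := (0 : F))).congr_of_eventuallyEq hev ?_
      rw [indicator_of_notMem (show τ ∉ Iio p₀.2 from not_lt.2 hgt.le)]

lemma NAdm.hasFDerivAt {C' b' : ℝ} {q' : ℝ → ℝ} {J' : E n → ℝ → ℝ → E n →L[ℝ] F} (h : NAdm T C b q J)
    (h' : NAdm T C' b' q' J')
    (hd : ∀ x, ∀ τ ∈ Ioo 0 T, ∀ s ∈ Ioo 0 T, HasFDerivAt (fun y => J y τ s) (J' x τ s) x)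
    (hq : IntegrableOn q (Ioo 0 T)) (hq' : IntegrableOn q' (Ioo 0 T))
    (hq0 : ∀ τ ∈ Ioo 0 T, 0 ≤ q' τ) (hC : 0 ≤ C') (hb : 0 ≤ b') {t : ℝ} (ht : t ≤ T) (x : E n) :
    HasFDerivAt (fun y => NN J y t) (NN J' x t) x := by
  unfold NN
  refine hasFDerivAt_integral_of_dominated_of_fderiv_le (𝕜 := ℝ)
      (F' := fun y τ => J' y τ (t - τ))
      (bound := fun τ => C' * Real.exp (b' * (‖x‖ + 1) ^ 2) * q' τ)
      (ball_mem_nhds x one_pos) (Eventually.of_forall fun y => h.meas ht y) (h.integrableOn hq ht x)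
      (h'.meas ht x) ?_ ((hq'.mono_set (Ioo_subset_Ioo_right ht)).const_mul _) ?_
  · refine (ae_restrict_iff' measurableSet_Ioo).2 (Eventually.of_forall fun τ hτ y hy => ?_)
    refine (h'.bdSlice ht y hτ).trans ?_
    have h2 : ‖y‖ ≤ ‖x‖ + 1 := by
      have := mem_ball_iff_norm.1 hy
      calc ‖y‖ = ‖x + (y - x)‖ := by congr 1; abel
        _ ≤ ‖x‖ + ‖y - x‖ := norm_add_le _ _
        _ ≤ _ := by gcongr
    have := hq0 τ ⟨hτ.1, hτ.2.trans_le ht⟩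
    gcongr
  · refine (ae_restrict_iff' measurableSet_Ioo).2 (Eventually.of_forall fun τ hτ y hy => ?_)
    exact hd y τ ⟨hτ.1, hτ.2.trans_le ht⟩ _ ⟨by linarith [hτ.2], by linarith [hτ.1]⟩

end nn

lemma tri_fubini {T C : ℝ} {q : ℝ → ℝ} {J : ℝ → ℝ → ℝ} (hq : IntegrableOn q (Ioo 0 T))
    (hJ : ContinuousOn (fun p : ℝ × ℝ => J p.1 p.2) (Ioo 0 T ×ˢ Ioo 0 T))
    (hb : ∀ r ∈ Ioo 0 T, ∀ s ∈ Ioo 0 T, |J r s| ≤ C * q r) {t : ℝ} (ht : t ≤ T) :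
    ∫ s in Ioo 0 t, ∫ r in Ioo 0 (t - s), J r s = ∫ ρ in Ioo 0 t, ∫ r in Ioo 0 ρ, J r (ρ - r) := by
  set D : Set (ℝ × ℝ) := {p | 0 < p.1 ∧ 0 < p.2 ∧ p.1 + p.2 < t} with hD
  have hDo : IsOpen D := by
    have h1 : IsOpen {p : ℝ × ℝ | 0 < p.1} := isOpen_lt (by fun_prop) (by fun_prop)
    have h2 : IsOpen {p : ℝ × ℝ | 0 < p.2} := isOpen_lt (by fun_prop) (by fun_prop)
    have h3 : IsOpen {p : ℝ × ℝ | p.1 + p.2 < t} := isOpen_lt (by fun_prop) (by fun_prop)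
    exact h1.inter (h2.inter h3)
  have hDs : D ⊆ Ioo 0 T ×ˢ Ioo 0 T := by
    rintro ⟨r, s⟩ ⟨h1, h2, h3⟩
    simp only at h1 h2 h3
    exact ⟨⟨h1, by simp only; linarith⟩, ⟨h2, by simp only; linarith⟩⟩
  set G : ℝ × ℝ → ℝ := D.indicator (fun p => J p.1 p.2) with hG
  have hGi : Integrable G := by
    have hdom : Integrable (fun p : ℝ × ℝ => (Ioo 0 T).indicator (fun r => C * q r) p.1 * (Ioo 0 T).indicator (fun _ => (1 : ℝ)) p.2) := by
      refine Integrable.mul_prod ?_ ?_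
      · exact (integrable_indicator_iff measurableSet_Ioo).2 (hq.const_mul C)
      · exact (integrable_indicator_iff measurableSet_Ioo).2 (one_integrable T)
    refine hdom.mono' ?_ (Eventually.of_forall fun p => ?_)
    · rw [hG, aestronglyMeasurable_indicator_iff hDo.measurableSet]
      exact (hJ.mono hDs).aestronglyMeasurable hDo.measurableSet
    · by_cases hp : p ∈ D
      · have := hDs hp
        rw [hG, indicator_of_mem hp, indicator_of_mem this.1, indicator_of_mem this.2, mul_one]
        exact hb _ this.1 _ this.2
      · rw [hG, indicator_of_notMem hp, norm_zero]
        by_cases h1 : p.1 ∈ Ioo 0 T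
        · by_cases h2 : p.2 ∈ Ioo 0 T
          · rw [indicator_of_mem h1, indicator_of_mem h2, mul_one]
            exact (abs_nonneg _).trans (hb _ h1 _ h2)
          · rw [indicator_of_notMem h2, mul_zero]
        · rw [indicator_of_notMem h1, zero_mul]
  have hL : ∫ s in Ioo 0 t, ∫ r in Ioo 0 (t - s), J r s = ∫ s, ∫ r, G (r, s) := by
    rw [← integral_indicator measurableSet_Ioo]
    congr 1; ext s
    by_cases hs : s ∈ Ioo 0 t
    · rw [indicator_of_mem hs, ← integral_indicator measurableSet_Ioo]
      congr 1; ext r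
      by_cases hr : r ∈ Ioo 0 (t - s)
      · rw [indicator_of_mem hr, hG, indicator_of_mem]
        exact ⟨hr.1, hs.1, by have := hr.2; simp only; linarith⟩
      · rw [indicator_of_notMem hr, hG, indicator_of_notMem]
        rintro ⟨h1, h2, h3⟩
        exact hr ⟨h1, by simp only at h3; linarith⟩
    · rw [indicator_of_notMem hs]
      symm
      rw [← integral_zero ℝ ℝ]
      congr 1; ext r
      rw [hG, indicator_of_notMem]
      rintro ⟨h1, h2, h3⟩
      exact hs ⟨h2, by simp only at h1 h3; linarith⟩
  have hR : ∫ ρ in Ioo 0 t, ∫ r in Ioo 0 ρ, J r (ρ - r) = ∫ ρ, ∫ r, G (r, ρ - r) := by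
    rw [← integral_indicator measurableSet_Ioo]
    congr 1; ext ρ
    by_cases hs : ρ ∈ Ioo 0 t
    · rw [indicator_of_mem hs, ← integral_indicator measurableSet_Ioo]
      congr 1; ext r
      by_cases hr : r ∈ Ioo 0 ρ
      · rw [indicator_of_mem hr, hG, indicator_of_mem]
        exact ⟨hr.1, by have := hr.2; simp only; linarith, by have := hs.2; simp only; linarith⟩
      · rw [indicator_of_notMem hr, hG, indicator_of_notMem]
        rintro ⟨h1, h2, h3⟩
        exact hr ⟨h1, by simp only at h2; linarith⟩
    · rw [indicator_of_notMem hs]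
      symm
      rw [← integral_zero ℝ ℝ]
      congr 1; ext r
      rw [hG, indicator_of_notMem]
      rintro ⟨h1, h2, h3⟩
      exact hs ⟨by simp only at h1 h2; linarith, by simp only at h3; linarith⟩
  rw [hL, hR]
  have hsh : Integrable (fun p : ℝ × ℝ => G (p.1, p.2 - p.1)) := by
    have := (measurePreserving_prod_neg_add (volume : Measure ℝ) (volume : Measure ℝ)).integrable_comp_of_integrable hGi
    refine this.congr (Eventually.of_forall fun p => ?_)
    simp only [Function.comp]
    congr 2; ring
  rw [← integral_integral_swap (f := fun r s => G (r, s)) hGi,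
    ← integral_integral_swap (f := fun r ρ => G (r, ρ - r)) hsh]
  congr 1; ext r
  exact (integral_sub_right_eq_self (fun s => G (r, s)) r).symm

section gr
variable {n : ℕ} {F : Type*} [NormedAddCommGroup F] [NormedSpace ℝ F]

/-- continuous functions on `ℝⁿ` with Gaussian growth -/
structure Gs (C a : ℝ) (g : E n → F) : Prop where
  cont : Continuous g
  bd : ∀ x, ‖g x‖ ≤ C * Real.exp (a * ‖x‖ ^ 2)

/-- continuous functions on `ℝⁿ × (0,T)` with Gaussian growth -/
structure Gr (T C a : ℝ) (f : E n → ℝ → F) : Prop where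
  nn : 0 ≤ C
  cont : ContinuousOn (fun p : E n × ℝ => f p.1 p.2) (univ ×ˢ Ioo 0 T)
  bd : ∀ x, ∀ s ∈ Ioo 0 T, ‖f x s‖ ≤ C * Real.exp (a * ‖x‖ ^ 2)

/-- Duhamel operator -/
def SS (f : E n → ℝ → F) (x : E n) (t : ℝ) : F := NN (fun x τ s => PA (√τ) (fun y => f y s) x) x t

variable {T C a : ℝ}

lemma Gs.nn {g : E n → F} (h : Gs C a g) : 0 ≤ C :=
  nonneg_of_mul_nonneg_left ((norm_nonneg _).trans (h.bd 0)) (Real.exp_pos _)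

lemma Gr.slice {f : E n → ℝ → F} (h : Gr T C a f) {s : ℝ} (hs : s ∈ Ioo 0 T) : Gs C a (fun y => f y s) where
  cont := by
    rw [← continuousOn_univ]
    exact h.cont.comp (f := fun y : E n => (y, s)) (by fun_prop) (fun y _ => ⟨mem_univ _, hs⟩)
  bd := fun x => h.bd x s hs

lemma Gr.mono {f : E n → ℝ → F} (h : Gr T C a f) {T' C' a' : ℝ} (hT : T' ≤ T) (hC : C ≤ C') (ha : a ≤ a') :
    Gr T' C' a' f where
  nn := h.nn.trans hC
  cont := h.cont.mono (prod_mono_right (Ioo_subset_Ioo_right hT))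
  bd := fun x s hs => by
    have := h.nn.trans hC
    refine (h.bd x s ⟨hs.1, hs.2.trans_le hT⟩).trans ?_
    gcongr

lemma Gs.mono {f : E n → F} (h : Gs C a f) {C' a' : ℝ} (hC : C ≤ C') (ha : a ≤ a') :
    Gs C' a' f where
  cont := h.cont
  bd := fun x => by
    have := h.nn.trans hC
    refine (h.bd x).trans ?_
    gcongr

lemma Gr.app {f : E n → ℝ → E n →L[ℝ] ℝ} (h : Gr T C a f) (j : Fin n) :
    Gr T C a (fun y s => f y s (EuclideanSpace.single j (1 : ℝ))) where
  nn := h.nn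
  cont := h.cont.clm_apply continuousOn_const
  bd := fun x s hs => (clm_single_bd _ j).trans (h.bd x s hs)

lemma Gs.app {f : E n → E n →L[ℝ] ℝ} (h : Gs C a f) (j : Fin n) :
    Gs C a (fun y => f y (EuclideanSpace.single j (1 : ℝ))) where
  cont := by have := h.cont; fun_prop
  bd := fun x => (clm_single_bd _ j).trans (h.bd x)

lemma sq_sqrt_le {a τ T : ℝ} (ha : 0 ≤ a) (haT : 16 * a * T ≤ 1) (hτ : 0 ≤ τ) (hτT : τ ≤ T) :
    16 * a * (√τ) ^ 2 ≤ 1 := by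
  rw [Real.sq_sqrt hτ]
  nlinarith

lemma AA_adm {m : E n → ℝ} (hmc : Continuous m) (hm : ∀ z, |m z| ≤ (1 + ‖z‖) ^ 2) (ha : 0 ≤ a)
    (haT : 16 * a * T ≤ 1) {f : E n → ℝ → F} (hf : Gr T C a f) :
    NAdm T (KK n * C) (2 * a) (fun _ => 1) (fun x τ s => AA m (√τ) (fun y => f y s) x) where
  cont := by
    refine (AA_cont hmc hm ha hf.cont hf.bd).comp (f := fun p : E n × ℝ × ℝ => (p.1, √p.2.1, p.2.2)) (by fun_prop) ?_
    rintro ⟨x, τ, s⟩ ⟨_, h1, h2⟩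
    exact ⟨mem_univ _, sq_sqrt_le ha haT h1.1.le h1.2.le, h2⟩
  bd := fun x τ hτ s hs => by
    rw [mul_one]
    exact AA_norm_le hm ha (sq_sqrt_le ha haT hτ.1.le hτ.2.le) (fun y => hf.bd y s hs) x

lemma PA_adm (ha : 0 ≤ a) (haT : 16 * a * T ≤ 1) {f : E n → ℝ → F} (hf : Gr T C a f) :
    NAdm T (KK n * C) (2 * a) (fun _ => 1) (fun x τ s => PA (√τ) (fun y => f y s) x) :=
  AA_adm continuous_const one_bd ha haT hf

lemma DA_norm_le {r : ℝ} (hr : 0 < r) (ha : 0 ≤ a) (har : 16 * a * r ^ 2 ≤ 1) {g : E n → ℝ} (hg : Gs C a g) (x : E n) :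
    ‖DA r g x‖ ≤ (n * (KK n * C)) * Real.exp (2 * a * ‖x‖ ^ 2) * r⁻¹ := by
  unfold DA
  have h1 : ∀ j : Fin n, ‖(AA (fun z : E n => z j) r g x) • (EuclideanSpace.proj j : E n →L[ℝ] ℝ)‖ ≤
      KK n * C * Real.exp (2 * a * ‖x‖ ^ 2) := by
    intro j
    rw [norm_smul]
    have h2 := AA_norm_le (coord_bd j) ha har hg.bd x
    have h3 : ‖(EuclideanSpace.proj j : E n →L[ℝ] ℝ)‖ ≤ 1 := by
      refine ContinuousLinearMap.opNorm_le_bound _ zero_le_one fun z => ?_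
      rw [one_mul]; exact PiLp.norm_apply_le z j
    calc _ ≤ (KK n * C * Real.exp (2 * a * ‖x‖ ^ 2)) * 1 := by
          gcongr
          exact (norm_nonneg _).trans h2
      _ = _ := mul_one _
  rw [norm_smul, norm_neg, Real.norm_of_nonneg (by positivity)]
  have h2 := norm_sum_le_of_le Finset.univ (fun j _ => h1 j)
  simp only [Finset.sum_const, Finset.card_univ, Fintype.card_fin, nsmul_eq_mul] at h2
  have h3 : 1 / (2 * r) ≤ r⁻¹ := by
    rw [← one_div]
    apply one_div_le_one_div_of_le hr; linarith
  calc _ ≤ r⁻¹ * (n * (KK n * C * Real.exp (2 * a * ‖x‖ ^ 2))) := by gcongr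
    _ = _ := by ring

lemma DA_adm (ha : 0 ≤ a) (haT : 16 * a * T ≤ 1) {f : E n → ℝ → ℝ} (hf : Gr T C a f) :
    NAdm T (n * (KK n * C)) (2 * a) (fun τ => (√τ)⁻¹) (fun x τ s => DA (√τ) (fun y => f y s) x) where
  cont := by
    unfold DA
    have h1 : ContinuousOn (fun p : E n × ℝ × ℝ => -(1 / (2 * √p.2.1))) (univ ×ˢ (Ioo 0 T ×ˢ Ioo 0 T)) := by
      refine (continuousOn_const.div (by fun_prop) ?_).neg
      rintro ⟨x, τ, s⟩ ⟨_, h1, h2⟩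
      have : 0 < √τ := Real.sqrt_pos.2 h1.1
      simp only; positivity
    refine h1.smul (continuousOn_finsetSum _ fun j _ => ?_)
    exact (AA_adm (coord_cont j) (coord_bd j) ha haT hf).cont.smul continuousOn_const
  bd := fun x τ hτ s hs => DA_norm_le (Real.sqrt_pos.2 hτ.1) ha (sq_sqrt_le ha haT hτ.1.le hτ.2.le) (hf.slice hs) x

lemma NAdm.app {b : ℝ} {q : ℝ → ℝ} {J : E n → ℝ → ℝ → E n →L[ℝ] ℝ} (h : NAdm T C b q J) (j : Fin n) :
    NAdm T C b q (fun x τ s => J x τ s (EuclideanSpace.single j (1 : ℝ))) where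
  cont := h.cont.clm_apply continuousOn_const
  bd := fun x τ hτ s hs => (clm_single_bd _ j).trans (h.bd x τ hτ s hs)

lemma NAdm.sum {b : ℝ} {q : ℝ → ℝ} {J : Fin n → E n → ℝ → ℝ → ℝ} (h : ∀ j, NAdm T C b q (J j)) :
    NAdm T (n * C) b q (fun x τ s => ∑ j, J j x τ s) where
  cont := continuousOn_finsetSum _ fun j _ => (h j).cont
  bd := fun x τ hτ s hs => by
    have h2 := norm_sum_le_of_le Finset.univ (fun j _ => (h j).bd x τ hτ s hs)
    simp only [Finset.sum_const, Finset.card_univ, Fintype.card_fin, nsmul_eq_mul] at h2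
    refine h2.trans (le_of_eq ?_); ring

lemma LA_adm (ha : 0 ≤ a) (haT : 16 * a * T ≤ 1) {f' : E n → ℝ → E n →L[ℝ] ℝ} (hf : Gr T C a f') :
    NAdm T (n * (n * (KK n * C))) (2 * a) (fun τ => (√τ)⁻¹) (fun x τ s => LA (√τ) (fun y => f' y s) x) := by
  unfold LA
  exact NAdm.sum fun j => (DA_adm ha haT (hf.app j)).app j

lemma NN_app {b : ℝ} {q : ℝ → ℝ} {J : E n → ℝ → ℝ → E n →L[ℝ] ℝ} (h : NAdm T C b q J)
    (hq : IntegrableOn q (Ioo 0 T)) {t : ℝ} (ht : t ≤ T) (x v : E n) :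
    NN J x t v = NN (fun x τ s => J x τ s v) x t := by
  unfold NN
  exact ContinuousLinearMap.integral_apply (h.integrableOn hq ht x) v

lemma PA_app {r : ℝ} (ha : 0 ≤ a) (har : 16 * a * r ^ 2 ≤ 1) {g : E n → E n →L[ℝ] ℝ} (hg : Gs C a g) (x v : E n) :
    PA r g x v = PA r (fun y => g y v) x := by
  unfold PA AA
  rw [ContinuousLinearMap.integral_apply (AA_integrable continuous_const one_bd ha har hg.cont hg.bd x)]
  simp

lemma NN_shift (J : E n → ℝ → ℝ → F) (x : E n) (t : ℝ) :
    NN J x t = ∫ s in Ioo 0 t, J x (t - s) s := by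
  unfold NN
  rw [← integral_indicator measurableSet_Ioo, ← integral_indicator measurableSet_Ioo,
    ← integral_sub_left_eq_self _ _ t]
  congr 1; ext s
  by_cases hs : s ∈ Ioo 0 t
  · rw [indicator_of_mem hs, indicator_of_mem (show t - s ∈ Ioo 0 t from ⟨by linarith [hs.2], by linarith [hs.1]⟩)]
    simp
  · rw [indicator_of_notMem hs, indicator_of_notMem]
    intro h; exact hs ⟨by linarith [h.2], by linarith [h.1]⟩

lemma const_gr {g : E n → F} (hg : Gs C a g) : Gr T C a (fun y _ => g y) where
  nn := hg.nn
  cont := by have := hg.cont; fun_prop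
  bd := fun x _ _ => hg.bd x

/-- joint continuity in `(x,t)` of time-independent data -/
lemma adm_contOn {b : ℝ} {q : ℝ → ℝ} {J : E n → ℝ → F} (h : NAdm T C b q (fun x τ _ => J x τ)) :
    ContinuousOn (fun p : E n × ℝ => J p.1 p.2) (univ ×ˢ Ioo 0 T) := by
  refine h.cont.comp (f := fun p : E n × ℝ => (p.1, p.2, p.2)) (by fun_prop) ?_
  rintro ⟨x, t⟩ ⟨_, h⟩
  exact ⟨mem_univ _, h, h⟩

lemma PA_sqrt_cont (ha : 0 ≤ a) (haT : 16 * a * T ≤ 1) {g : E n → F} (hg : Gs C a g) :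
    ContinuousOn (fun p : E n × ℝ => PA (√p.2) g p.1) (univ ×ˢ Icc 0 T) := by
  refine (AA_cont (m := fun _ : E n => (1 : ℝ)) continuous_const one_bd ha (I := univ) (f := fun y _ => g y)
    (by have := hg.cont; fun_prop) (fun x _ _ => hg.bd x)).comp (f := fun p : E n × ℝ => (p.1, √p.2, p.2)) (by fun_prop) ?_
  rintro ⟨x, τ⟩ ⟨_, h1⟩
  exact ⟨mem_univ _, sq_sqrt_le ha haT h1.1 h1.2, mem_univ _⟩

lemma SS_cont (ha : 0 ≤ a) (haT : 16 * a * T ≤ 1) {f : E n → ℝ → F} (hf : Gr T C a f) :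
    ContinuousOn (fun p : E n × ℝ => SS f p.1 p.2) (univ ×ˢ Iic T) :=
  (PA_adm ha haT hf).continuousOn (one_integrable T) (fun _ _ => zero_le_one)
    (mul_nonneg KK_pos.le hf.nn) (by positivity)

lemma SS_norm_le (hT : 0 ≤ T) (ha : 0 ≤ a) (haT : 16 * a * T ≤ 1) {f : E n → ℝ → F} (hf : Gr T C a f) {t : ℝ}
    (ht : t ≤ T) (x : E n) : ‖SS f x t‖ ≤ (KK n * C * T) * Real.exp (2 * a * ‖x‖ ^ 2) := by
  have := (PA_adm ha haT hf).norm_le (one_integrable T) (fun _ _ => zero_le_one)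
    (mul_nonneg KK_pos.le hf.nn) ht x
  simpa [hT, SS] using this

end gr

section regcore
variable {n : ℕ} {T a Ch Ch' Cf Cf' : ℝ}
  {h : E n → ℝ} {h' : E n → E n →L[ℝ] ℝ} {f : E n → ℝ → ℝ} {f' : E n → ℝ → E n →L[ℝ] ℝ}

lemma integral_Ioo_eq (φ : ℝ → ℝ) {t : ℝ} (ht : 0 ≤ t) : ∫ s in Ioo 0 t, φ s = ∫ s in (0 : ℝ)..t, φ s := by
  rw [intervalIntegral.integral_of_le ht, integral_Ioc_eq_integral_Ioo]

lemma PA_ftc (ha : 0 ≤ a) (haT : 16 * a * T ≤ 1) {g : E n → ℝ} {g' : E n → E n →L[ℝ] ℝ}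
    (hg : Gs Cf a g) (hg' : Gs Cf' a g') (hgd : ∀ x, HasFDerivAt g (g' x) x) (x : E n)
    {τ : ℝ} (hτ : 0 ≤ τ) (hτT : τ ≤ T) :
    PA (√τ) g x = g x + ∫ r in Ioo 0 τ, LA (√r) g' x := by
  have hadm := LA_adm (T := T) ha haT (const_gr (T := T) hg')
  have h1 := intervalIntegral.integral_eq_sub_of_hasDerivAt_of_le (f := fun t => PA (√t) g x)
    (f' := fun t => LA (√t) g' x) hτ ?_ ?_ ?_
  · rw [integral_Ioo_eq _ hτ, h1]
    simp only [Real.sqrt_zero]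
    rw [PA_zero]; ring
  · refine (PA_sqrt_cont ha haT hg).comp (f := fun t : ℝ => (x, t)) (by fun_prop) (fun t ht => ?_)
    exact ⟨mem_univ _, ht.1, ht.2.trans hτT⟩
  · intro t ht
    refine PA_hasDerivAt_time ha ht.1 ?_ hgd hg'.cont hg.bd hg'.bd x
    rcases ha.eq_or_lt with h0 | h0
    · rw [← h0]; norm_num
    · have : t < T := ht.2.trans_le hτT
      nlinarith
  · rw [intervalIntegrable_iff_integrableOn_Ioo_of_le hτ]
    exact hadm.integrableOn (sqrt_inv_integrable T) hτT x

/-- time integral representation of the Duhamel term -/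
lemma SS_eq_integral (ha : 0 ≤ a) (haT : 16 * a * T ≤ 1) (hf : Gr T Cf a f) (hf' : Gr T Cf' a f')
    (hfd : ∀ x, ∀ s ∈ Ioo 0 T, HasFDerivAt (fun y => f y s) (f' x s) x) (x : E n) {t : ℝ} (ht : t ≤ T) :
    SS f x t = ∫ ρ in Ioo 0 t, (f x ρ + NN (fun x τ s => LA (√τ) (fun y => f' y s) x) x ρ) := by
  have hadm := LA_adm (T := T) ha haT hf'
  rcases le_or_gt t 0 with h0 | h0
  · simp [SS, NN, Ioo_eq_empty (not_lt.2 h0)]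
  have hfi : IntegrableOn (fun ρ => f x ρ) (Ioo 0 t) := by
    have hc : ContinuousOn (fun ρ => f x ρ) (Ioo 0 t) :=
      hf.cont.comp (f := fun ρ : ℝ => (x, ρ)) (by fun_prop) (fun ρ hρ => ⟨mem_univ _, hρ.1, hρ.2.trans_le ht⟩)
    refine Integrable.mono' ((one_integrable t).const_mul (Cf * Real.exp (a * ‖x‖ ^ 2)))
      (hc.aestronglyMeasurable measurableSet_Ioo) ?_
    refine (ae_restrict_iff' measurableSet_Ioo).2 (Eventually.of_forall fun ρ hρ => ?_)
    rw [mul_one]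
    exact hf.bd x ρ ⟨hρ.1, hρ.2.trans_le ht⟩
  have hNc : ContinuousOn (fun ρ => NN (fun x τ s => LA (√τ) (fun y => f' y s) x) x ρ) (Icc 0 t) := by
    refine (hadm.continuousOn (sqrt_inv_integrable T) (fun τ _ => by positivity) ?_ (by positivity)).comp
      (f := fun ρ : ℝ => (x, ρ)) (by fun_prop) (fun ρ hρ => ⟨mem_univ _, hρ.2.trans ht⟩)
    have := hf'.nn; have := KK_pos (n := n); positivity
  have hNi : IntegrableOn (fun ρ => NN (fun x τ s => LA (√τ) (fun y => f' y s) x) x ρ) (Ioo 0 t) :=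
    (hNc.integrableOn_compact isCompact_Icc).mono_set Ioo_subset_Icc_self
  have hfub := tri_fubini (T := T) (C := (n * (n * (KK n * Cf'))) * Real.exp (2 * a * ‖x‖ ^ 2))
    (q := fun τ => (√τ)⁻¹) (J := fun r s => LA (√r) (fun y => f' y s) x) (sqrt_inv_integrable T)
    (hadm.cont.comp (f := fun p : ℝ × ℝ => (x, p.1, p.2)) (by fun_prop) (fun p hp => ⟨mem_univ _, hp⟩))
    (fun r hr s hs => hadm.bd x r hr s hs) ht
  rw [integral_add hfi hNi]
  have e2 : ∫ ρ in Ioo 0 t, NN (fun x τ s => LA (√τ) (fun y => f' y s) x) x ρ =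
    ∫ s in Ioo 0 t, ∫ r in Ioo 0 (t - s), LA (√r) (fun y => f' y s) x := hfub.symm
  have hPi : IntegrableOn (fun s => PA (√(t - s)) (fun y => f y s) x) (Ioo 0 t) := by
    have hadm2 := PA_adm ha haT hf
    have hc : ContinuousOn (fun s => PA (√(t - s)) (fun y => f y s) x) (Ioo 0 t) :=
      hadm2.cont.comp (f := fun s : ℝ => (x, t - s, s)) (by fun_prop)
        (fun s hs => ⟨mem_univ _, ⟨by have := hs.2; simp only; linarith, by have := hs.1; simp only; linarith⟩, ⟨hs.1, hs.2.trans_le ht⟩⟩)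
    refine Integrable.mono' ((one_integrable t).const_mul (KK n * Cf * Real.exp (2 * a * ‖x‖ ^ 2)))
      (hc.aestronglyMeasurable measurableSet_Ioo) ?_
    refine (ae_restrict_iff' measurableSet_Ioo).2 (Eventually.of_forall fun s hs => ?_)
    exact hadm2.bd x (t - s) ⟨by linarith [hs.2], by linarith [hs.1]⟩ s ⟨hs.1, hs.2.trans_le ht⟩
  have e3 : ∀ s ∈ Ioo 0 t, ∫ r in Ioo 0 (t - s), LA (√r) (fun y => f' y s) x =
      PA (√(t - s)) (fun y => f y s) x - f x s := by
    intro s hs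
    have hs' : s ∈ Ioo 0 T := ⟨hs.1, hs.2.trans_le ht⟩
    rw [PA_ftc ha haT (hf.slice hs') (hf'.slice hs') (fun x => hfd x s hs') x (by linarith [hs.2]) (by linarith [hs.1])]
    ring
  rw [e2, setIntegral_congr_fun measurableSet_Ioo e3, integral_sub hPi hfi]
  unfold SS
  rw [NN_shift]; ring

lemma SS_hasDerivAt (ha : 0 ≤ a) (haT : 16 * a * T ≤ 1) (hf : Gr T Cf a f) (hf' : Gr T Cf' a f')
    (hfd : ∀ x, ∀ s ∈ Ioo 0 T, HasFDerivAt (fun y => f y s) (f' x s) x) (x : E n) {t : ℝ} (ht : t ∈ Ioo 0 T) :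
    HasDerivAt (fun t => SS f x t) (f x t + NN (fun x τ s => LA (√τ) (fun y => f' y s) x) x t) t := by
  have hadm := LA_adm (T := T) ha haT hf'
  set φ : ℝ → ℝ := fun ρ => f x ρ + NN (fun x τ s => LA (√τ) (fun y => f' y s) x) x ρ with hφ
  have hfc : ContinuousOn (fun ρ => f x ρ) (Ioo 0 T) :=
      hf.cont.comp (f := fun ρ : ℝ => (x, ρ)) (by fun_prop) (fun ρ hρ => ⟨mem_univ _, hρ.1, hρ.2⟩)
  have hfi : IntegrableOn (fun ρ => f x ρ) (Ioo 0 T) := by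
    refine Integrable.mono' ((one_integrable T).const_mul (Cf * Real.exp (a * ‖x‖ ^ 2)))
      (hfc.aestronglyMeasurable measurableSet_Ioo) ?_
    refine (ae_restrict_iff' measurableSet_Ioo).2 (Eventually.of_forall fun ρ hρ => ?_)
    rw [mul_one]
    exact hf.bd x ρ hρ
  have hNc : ContinuousOn (fun ρ => NN (fun x τ s => LA (√τ) (fun y => f' y s) x) x ρ) (Icc 0 T) := by
    refine (hadm.continuousOn (sqrt_inv_integrable T) (fun τ _ => by positivity) ?_ (by positivity)).comp
      (f := fun ρ : ℝ => (x, ρ)) (by fun_prop) (fun ρ hρ => ⟨mem_univ _, hρ.2⟩)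
    have := hf'.nn; have := KK_pos (n := n); positivity
  have hNi : IntegrableOn (fun ρ => NN (fun x τ s => LA (√τ) (fun y => f' y s) x) x ρ) (Ioo 0 T) :=
    (hNc.integrableOn_compact isCompact_Icc).mono_set Ioo_subset_Icc_self
  have hφi : IntegrableOn φ (Ioo 0 T) := hfi.add hNi
  have hφc : ContinuousOn φ (Ioo 0 T) := hfc.add (hNc.mono Ioo_subset_Icc_self)
  have key : HasDerivAt (fun t => ∫ ρ in (0 : ℝ)..t, φ ρ) (φ t) t := by
    refine intervalIntegral.integral_hasDerivAt_right ?_ ?_ (hφc.continuousAt (Ioo_mem_nhds ht.1 ht.2))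
    · rw [intervalIntegrable_iff_integrableOn_Ioo_of_le ht.1.le]
      exact hφi.mono_set (Ioo_subset_Ioo_right ht.2.le)
    · exact hφc.stronglyMeasurableAtFilter isOpen_Ioo t ht
  refine key.congr_of_eventuallyEq ?_
  filter_upwards [Ioo_mem_nhds ht.1 ht.2] with s hs
  rw [SS_eq_integral ha haT hf hf' hfd x hs.2.le, integral_Ioo_eq _ hs.1.le]

/-- Core regularity statement. -/
lemma reg_core (ha : 0 ≤ a) (haT : 32 * a * T ≤ 1) (hh : Gs Ch a h) (hh' : Gs Ch' a h')
    (hhd : ∀ x, HasFDerivAt h (h' x) x) (hf : Gr T Cf a f) (hf' : Gr T Cf' a f')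
    (hfd : ∀ x, ∀ s ∈ Ioo 0 T, HasFDerivAt (fun y => f y s) (f' x s) x)
    {U : E n → ℝ → ℝ} (hU : ∀ x, ∀ t ∈ Ioo 0 T, U x t = PA (√t) h x - SS f x t) :
    IsC21 (univ ×ˢ Ioo 0 T) U ∧ ∀ x, ∀ t ∈ Ioo 0 T, deriv (U x) t = lap (fun y => U y t) x - f x t := by
  rcases le_or_gt T 0 with hT0 | hT0
  · have : Ioo 0 T = ∅ := Ioo_eq_empty (not_lt.2 hT0)
    rw [this]
    refine ⟨⟨?_, ?_, ?_, ?_⟩, ?_⟩ <;> simp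
  have haT' : 16 * a * T ≤ 1 := by nlinarith [mul_nonneg ha hT0.le]
  have hK := KK_pos (n := n)
  have hsub : (univ : Set (E n)) ×ˢ Ioo 0 T ⊆ univ ×ˢ Iic T := prod_mono_right (fun t ht => ht.2.le)
  have hsub2 : (univ : Set (E n)) ×ˢ Ioo 0 T ⊆ univ ×ˢ Icc 0 T := prod_mono_right (fun t ht => ⟨ht.1.le, ht.2.le⟩)
  -- first derivatives
  have d1 : ∀ x, ∀ t ∈ Ioo 0 T, HasFDerivAt (fun y => U y t) (PA (√t) h' x - SS f' x t) x := by
    intro x t ht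
    have e : (fun y => U y t) = fun y => PA (√t) h y - SS f y t := by ext y; exact hU y t ht
    rw [e]
    refine (PA_hasFDerivAt ha (sq_sqrt_le ha haT' ht.1.le ht.2.le) hhd hh'.cont hh.bd hh'.bd x).sub ?_
    refine (PA_adm ha haT' hf).hasFDerivAt (PA_adm ha haT' hf') ?_ (one_integrable T) (one_integrable T)
      (fun _ _ => zero_le_one) (mul_nonneg hK.le hf'.nn) (by positivity) ht.2.le x
    intro x τ hτ s hs
    exact PA_hasFDerivAt ha (sq_sqrt_le ha haT' hτ.1.le hτ.2.le) (fun x => hfd x s hs) (hf'.slice hs).cont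
      (hf.slice hs).bd (hf'.slice hs).bd x
  -- second derivatives
  have d2 : ∀ (j : Fin n) x, ∀ t ∈ Ioo 0 T, HasFDerivAt (fun y => fderiv ℝ (fun y => U y t) y (EuclideanSpace.single j (1 : ℝ)))
      (DA (√t) (fun y => h' y (EuclideanSpace.single j (1 : ℝ))) x -
        NN (fun x τ s => DA (√τ) (fun y => f' y s (EuclideanSpace.single j (1 : ℝ))) x) x t) x := by
    intro j x t ht
    have e : (fun y => fderiv ℝ (fun y => U y t) y (EuclideanSpace.single j (1 : ℝ))) =
        fun y => PA (√t) (fun y => h' y (EuclideanSpace.single j (1 : ℝ))) y -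
          SS (fun y s => f' y s (EuclideanSpace.single j (1 : ℝ))) y t := by
      ext y
      rw [(d1 y t ht).fderiv]
      simp only [sub_apply]
      congr 1
      · exact PA_app ha (sq_sqrt_le ha haT' ht.1.le ht.2.le) hh' y _
      · unfold SS
        rw [NN_app (PA_adm ha haT' hf') (one_integrable T) ht.2.le]
        unfold NN
        refine setIntegral_congr_fun measurableSet_Ioo fun τ hτ => ?_
        refine PA_app (C := Cf') ha (sq_sqrt_le ha haT' hτ.1.le (hτ.2.le.trans ht.2.le)) (hf'.slice ?_) y _
        exact ⟨by linarith [hτ.2], by linarith [hτ.1, ht.2]⟩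
    rw [e]
    have h32 : ∀ τ ∈ Ioo 0 T, 32 * a * (√τ) ^ 2 ≤ 1 := by
      intro τ hτ
      rw [Real.sq_sqrt hτ.1.le]
      nlinarith [hτ.2.le]
    refine (PA_hasFDerivAt_kernel (Real.sqrt_pos.2 ht.1) ha (h32 t ht) (hh'.app j).cont (hh'.app j).bd x).sub ?_
    refine (PA_adm ha haT' (hf'.app j)).hasFDerivAt (DA_adm ha haT' (hf'.app j)) ?_ (one_integrable T)
      (sqrt_inv_integrable T) (fun τ _ => by positivity) ?_ (by positivity) ht.2.le x
    · intro x τ hτ s hs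
      exact PA_hasFDerivAt_kernel (Real.sqrt_pos.2 hτ.1) ha (h32 τ hτ) ((hf'.app j).slice hs).cont
        ((hf'.app j).slice hs).bd x
    · have := hf'.nn; positivity
  -- time derivative
  have dt : ∀ x, ∀ t ∈ Ioo 0 T, deriv (U x) t = LA (√t) h' x -
      (f x t + NN (fun x τ s => LA (√τ) (fun y => f' y s) x) x t) := by
    intro x t ht
    have h1 := (PA_hasDerivAt_time ha ht.1 (by nlinarith [ht.2.le, ht.1]) hhd hh'.cont hh.bd hh'.bd x).sub
      (SS_hasDerivAt ha haT' hf hf' hfd x ht)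
    refine HasDerivAt.deriv (h1.congr_of_eventuallyEq ?_)
    filter_upwards [Ioo_mem_nhds ht.1 ht.2] with s hs
    exact hU x s hs
  have hp2 : ∀ i j x, ∀ t ∈ Ioo 0 T, pd2 (fun y => U y t) i j x =
      DA (√t) (fun y => h' y (EuclideanSpace.single j (1 : ℝ))) x (EuclideanSpace.single i (1 : ℝ)) -
        NN (fun x τ s => DA (√τ) (fun y => f' y s (EuclideanSpace.single j (1 : ℝ))) x (EuclideanSpace.single i (1 : ℝ))) x t := by
    intro i j x t ht
    unfold pd2
    rw [(d2 j x t ht).fderiv, sub_apply]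
    rw [NN_app (DA_adm ha haT' (hf'.app j)) (sqrt_inv_integrable T) ht.2.le]
  refine ⟨⟨?_, ?_, ?_, ?_⟩, ?_⟩
  · refine ContinuousOn.congr (((PA_sqrt_cont ha haT' hh).mono hsub2).sub ((SS_cont ha haT' hf).mono hsub)) ?_
    rintro ⟨x, t⟩ ⟨_, ht⟩
    exact hU x t ht
  · have c1 := adm_contOn (J := fun x τ => LA (√τ) h' x) (LA_adm (T := T) ha haT' (const_gr hh'))
    have c2 := ((LA_adm (T := T) ha haT' hf').continuousOn (sqrt_inv_integrable T) (fun τ _ => by positivity)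
      (by have := hf'.nn; positivity) (by positivity)).mono hsub
    refine ContinuousOn.congr (c1.sub (hf.cont.add c2)) ?_
    rintro ⟨x, t⟩ ⟨_, ht⟩
    exact dt x t ht
  · intro i
    refine ContinuousOn.congr ((((PA_sqrt_cont ha haT' hh').mono hsub2).sub ((SS_cont ha haT' hf').mono hsub)).clm_apply
      (continuousOn_const (c := EuclideanSpace.single i (1 : ℝ)))) ?_
    rintro ⟨x, t⟩ ⟨_, ht⟩
    simp only
    rw [(d1 x t ht).fderiv]
    rfl
  · intro i j
    have c1 := adm_contOn (J := fun x τ => DA (√τ) (fun y => h' y (EuclideanSpace.single j (1 : ℝ))) x (EuclideanSpace.single i (1 : ℝ)))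
      ((DA_adm (T := T) ha haT' (const_gr (hh'.app j))).app i)
    have c2 := (((DA_adm (T := T) ha haT' (hf'.app j)).app i).continuousOn (sqrt_inv_integrable T) (fun τ _ => by positivity)
      (by have := hf'.nn; positivity) (by positivity)).mono hsub
    refine ContinuousOn.congr (c1.sub c2) ?_
    rintro ⟨x, t⟩ ⟨_, ht⟩
    exact hp2 i j x t ht
  · intro x t ht
    rw [dt x t ht]
    unfold lap
    rw [Finset.sum_congr rfl (fun i _ => hp2 i i x t ht), Finset.sum_sub_distrib]
    have e : NN (fun x τ s => LA (√τ) (fun y => f' y s) x) x t = ∑ i : Fin n,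
        NN (fun x τ s => DA (√τ) (fun y => f' y s (EuclideanSpace.single i (1 : ℝ))) x (EuclideanSpace.single i (1 : ℝ))) x t := by
      unfold NN LA
      rw [integral_finsetSum]
      intro i _
      exact ((DA_adm (T := T) ha haT' (hf'.app i)).app i).integrableOn (sqrt_inv_integrable T) ht.2.le x
    rw [e]
    unfold LA
    ring

end regcore

section restart
variable {n : ℕ} {T a C b : ℝ} {q : ℝ → ℝ}

lemma PA_NN {J : E n → ℝ → ℝ → ℝ} (h : NAdm T C b q J) (hq : IntegrableOn q (Ioo 0 T)) (hb : 0 ≤ b)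
    {r t : ℝ} (hr : 16 * b * r ^ 2 ≤ 1) (ht : t ≤ T) (x : E n) :
    PA r (fun y => NN J y t) x = NN (fun x τ s => PA r (fun y => J y τ s) x) x t := by
  unfold PA AA NN
  simp_rw [← integral_smul]
  rw [integral_integral_swap]
  have hpt : ∀ z : E n, ∀ τ ∈ Ioo 0 t, ‖(gk n z * 1) • J (x - r • z) τ (t - τ)‖ ≤
      (Real.exp (2 * b * ‖x‖ ^ 2) * wk n z) * (C * q τ) := by
    intro z τ hτ
    have := AA_ptbound (m := fun _ => 1) (C := C * q τ) (g := fun y => J y τ (t - τ)) one_bd hb hr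
      (fun y => by
        have := h.bdSlice ht y hτ
        refine this.trans (le_of_eq ?_); ring) x z
    refine this.trans (le_of_eq ?_); ring
  have hdom : Integrable (fun p : E n × ℝ => (Real.exp (2 * b * ‖x‖ ^ 2) * wk n p.1) * (C * q p.2))
      ((volume : Measure (E n)).prod (volume.restrict (Ioo 0 t))) :=
    Integrable.mul_prod (wk_integrable.const_mul _) ((hq.mono_set (Ioo_subset_Ioo_right ht)).const_mul _)
  have hmeq : (volume : Measure (E n)).prod (volume.restrict (Ioo 0 t)) =
      ((volume : Measure (E n)).prod (volume : Measure ℝ)).restrict (univ ×ˢ Ioo 0 t) := by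
    rw [← Measure.prod_restrict, Measure.restrict_univ]
  refine hdom.mono' ?_ ?_
  · rw [hmeq]
    refine ContinuousOn.aestronglyMeasurable ?_ (MeasurableSet.univ.prod measurableSet_Ioo)
    have hg := gk_cont (n := n)
    refine ContinuousOn.smul (f := fun p : E n × ℝ => gk n p.1 * 1) (by fun_prop) ?_
    refine h.cont.comp (f := fun p : E n × ℝ => (x - r • p.1, p.2, t - p.2)) (by fun_prop) ?_
    rintro ⟨z, τ⟩ ⟨_, hτ⟩
    simp only at hτ
    exact ⟨mem_univ _, ⟨hτ.1, hτ.2.trans_le ht⟩, ⟨by simpa using hτ.2, by have := hτ.1; simp only; linarith⟩⟩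
  · rw [hmeq]
    refine (ae_restrict_iff' (MeasurableSet.univ.prod measurableSet_Ioo)).2 (Eventually.of_forall ?_)
    rintro ⟨z, τ⟩ ⟨_, hτ⟩
    exact hpt z τ hτ

lemma Ioo_split {φ : ℝ → ℝ} {τ t : ℝ} (hτ : 0 < τ) (ht : 0 < t) (hφ : IntegrableOn φ (Ioo 0 (t + τ))) :
    ∫ σ in Ioo 0 (t + τ), φ σ = (∫ σ in Ioo 0 τ, φ σ) + ∫ σ in Ioo 0 t, φ (τ + σ) := by
  have hi : IntervalIntegrable φ volume 0 (t + τ) := by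
    rwa [intervalIntegrable_iff_integrableOn_Ioo_of_le (by linarith)]
  rw [integral_Ioo_eq _ (by linarith), integral_Ioo_eq _ hτ.le, integral_Ioo_eq _ ht.le]
  rw [intervalIntegral.integral_comp_add_left (fun σ => φ σ) τ]
  rw [← intervalIntegral.integral_add_adjacent_intervals (b := τ)]
  · simp [add_comm]
  · exact hi.mono_set (by rw [uIcc_of_le hτ.le, uIcc_of_le (by linarith)]; exact Icc_subset_Icc_right (by linarith))
  · exact hi.mono_set (by rw [uIcc_of_le (by linarith), uIcc_of_le (by linarith)]; exact Icc_subset_Icc_left (by linarith))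

lemma restart {C₀ Cf : ℝ} {u₀ : E n → ℝ} {f : E n → ℝ → ℝ} (ha : 0 ≤ a) (haT : 64 * a * T ≤ 1)
    (hu : Gs C₀ a u₀) (hf : Gr T Cf a f) {t₀ : ℝ} (ht₀ : 0 < t₀) {τ : ℝ} (hτ : 0 < τ) (hτT : t₀ + τ ≤ T)
    {h : E n → ℝ} (hh : ∀ x, h x = PA (√t₀) u₀ x - SS f x t₀) (x : E n) :
    PA (√τ) h x - SS (fun y s => f y (t₀ + s)) x τ = PA (√(t₀ + τ)) u₀ x - SS f x (t₀ + τ) := by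
  have hT0 : 0 < T := by linarith
  have haT' : 16 * a * T ≤ 1 := by nlinarith [mul_nonneg ha hT0.le]
  have h64 : ∀ s, 0 ≤ s → s ≤ T → 64 * a * s ≤ 1 := fun s hs hsT => by nlinarith
  have h2 : 16 * (2 * a) * (√τ) ^ 2 ≤ 1 := by
    rw [Real.sq_sqrt hτ.le]
    nlinarith [h64 τ hτ.le (by linarith), mul_nonneg ha hτ.le]
  have e0 : h = fun y => PA (√t₀) u₀ y - SS f y t₀ := funext hh
  have hadm := PA_adm ha haT' hf
  have hSc : Continuous (fun y => SS f y t₀) := by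
    rw [← continuousOn_univ]
    exact (SS_cont ha haT' hf).comp (f := fun y : E n => (y, t₀)) (by fun_prop)
      (fun y _ => ⟨mem_univ _, by simp only [mem_Iic]; linarith⟩)
  have hq1 : 16 * a * (√t₀) ^ 2 ≤ 1 := sq_sqrt_le ha haT' ht₀.le (by linarith)
  rw [e0, PA_sub (a := 2 * a) (by positivity) h2 (PA_continuous ha hq1 hu.cont hu.bd)
    (fun y => AA_norm_le one_bd ha hq1 hu.bd y) hSc (fun y => SS_norm_le hT0.le ha haT' hf (by linarith) y),
    PA_semi hτ ht₀ ha (by nlinarith [h64 τ hτ.le (by linarith), mul_nonneg ha hτ.le])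
      (by nlinarith [h64 t₀ ht₀.le (by linarith), mul_nonneg ha ht₀.le]) hu.cont hu.bd]
  have e1 : PA (√τ) (fun y => SS f y t₀) x = ∫ σ in Ioo 0 t₀, PA (√(τ + σ)) (fun y => f y (t₀ - σ)) x := by
    unfold SS
    rw [PA_NN hadm (one_integrable T) (by positivity) h2 (by linarith)]
    unfold NN
    refine setIntegral_congr_fun measurableSet_Ioo fun σ hσ => ?_
    have hs : t₀ - σ ∈ Ioo 0 T := ⟨by linarith [hσ.2], by linarith [hσ.1]⟩
    have hσT : σ ≤ T := by linarith [hσ.2]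
    exact PA_semi hτ hσ.1 ha (by nlinarith [h64 τ hτ.le (by linarith), mul_nonneg ha hτ.le])
      (by nlinarith [h64 σ hσ.1.le hσT, mul_nonneg ha hσ.1.le]) (hf.slice hs).cont (hf.slice hs).bd x
  have e2 : SS f x (t₀ + τ) = SS (fun y s => f y (t₀ + s)) x τ +
      ∫ σ in Ioo 0 t₀, PA (√(τ + σ)) (fun y => f y (t₀ - σ)) x := by
    unfold SS NN
    rw [Ioo_split hτ ht₀ (hadm.integrableOn (one_integrable T) hτT x)]
    congr 1
    · refine setIntegral_congr_fun measurableSet_Ioo fun σ hσ => ?_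
      simp only [add_sub_assoc]
    · refine setIntegral_congr_fun measurableSet_Ioo fun σ hσ => ?_
      have : t₀ + τ - (τ + σ) = t₀ - σ := by ring
      simp only [this]
  rw [e1, e2, add_comm τ t₀]; ring

end restart

section regthm
variable {n : ℕ}

lemma lb_pow {ν c p X w : ℝ} (hν : 0 < ν) (hc : 0 < c) (hp : 0 ≤ p) (hp2 : p ≤ 1 + ν) (hX : 0 ≤ X)
    (hw : c * (1 + X) ^ (-(1 / (1 + ν))) ≤ w) : w ^ (-p) ≤ c ^ (-p) * (1 + X) := by
  have h1 : 0 < c * (1 + X) ^ (-(1 / (1 + ν))) := by positivity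
  have h2 : w ^ (-p) ≤ (c * (1 + X) ^ (-(1 / (1 + ν)))) ^ (-p) :=
    Real.rpow_le_rpow_of_nonpos h1 hw (by linarith)
  refine h2.trans ?_
  rw [Real.mul_rpow hc.le (by positivity), ← Real.rpow_mul (by positivity)]
  have h3 : (1 + X) ^ (-(1 / (1 + ν)) * -p) ≤ (1 + X) ^ (1 : ℝ) := by
    apply Real.rpow_le_rpow_of_exponent_le (by linarith)
    have : -(1 / (1 + ν)) * -p = p / (1 + ν) := by ring
    rw [this, div_le_one (by linarith)]; exact hp2
  rw [Real.rpow_one] at h3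
  gcongr

lemma one_add_le_exp_mul {a X : ℝ} (ha : 0 < a) (hX : 0 ≤ X) : 1 + X ≤ (1 + 1 / a) * Real.exp (a * X) := by
  have h1 := Real.add_one_le_exp (a * X)
  calc 1 + X ≤ (1 + 1 / a) * (a * X + 1) := by
        have : (1 + 1 / a) * (a * X + 1) = 1 + X + a * X + 1 / a := by field_simp; ring
        rw [this]
        have : 0 ≤ a * X + 1 / a := by positivity
        linarith
    _ ≤ _ := by gcongr

lemma nl_gr {ν c a T : ℝ} {u : E n → ℝ → ℝ} (hν : 0 < ν) (hc : 0 < c) (ha : 0 < a)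
    (huc : ContinuousOn (fun p : E n × ℝ => u p.1 p.2) (univ ×ˢ Ioo 0 T))
    (hlb : ∀ x, ∀ t ∈ Ioo 0 T, c * (1 + ‖x‖ ^ 2) ^ (-(1 / (1 + ν))) ≤ u x t)
    {p : ℝ} (hp : 0 ≤ p) (hp2 : p ≤ 1 + ν) :
    Gr T (c ^ (-p) * (1 + 1 / a)) a (fun y s => u y s ^ (-p)) where
  nn := by positivity
  cont := by
    refine huc.rpow_const ?_
    rintro ⟨x, t⟩ ⟨_, ht⟩
    left
    have : 0 < c * (1 + ‖x‖ ^ 2) ^ (-(1 / (1 + ν))) := by positivity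
    exact (this.trans_le (hlb x t ht)).ne'
  bd := fun x t ht => by
    have hpos : 0 < u x t := by
      have : 0 < c * (1 + ‖x‖ ^ 2) ^ (-(1 / (1 + ν))) := by positivity
      exact this.trans_le (hlb x t ht)
    rw [Real.norm_of_nonneg (by positivity)]
    refine (lb_pow hν hc hp hp2 (sq_nonneg _) (hlb x t ht)).trans ?_
    rw [mul_assoc]
    gcongr
    exact one_add_le_exp_mul ha (sq_nonneg _)

lemma shift_contOn {T : ℝ} {Φ : E n → ℝ → ℝ}
    (h : ∀ t₁ ∈ Ioo 0 T, ContinuousOn (fun p : E n × ℝ => Φ p.1 (t₁ + p.2)) (univ ×ˢ Ioo 0 (T - t₁))) :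
    ContinuousOn (fun p : E n × ℝ => Φ p.1 p.2) (univ ×ˢ Ioo 0 T) := by
  rintro ⟨x, t⟩ ⟨_, ht⟩
  simp only at ht
  have h1 := h (t / 2) ⟨by linarith [ht.1], by linarith [ht.1, ht.2]⟩
  have h2 : ContinuousAt (fun p : E n × ℝ => Φ p.1 (t / 2 + p.2)) (x, t - t / 2) := by
    refine h1.continuousAt ((isOpen_univ.prod isOpen_Ioo).mem_nhds ⟨mem_univ _, ?_⟩)
    exact ⟨by simp only; linarith [ht.1], by simp only; linarith [ht.2]⟩
  have h3 : ContinuousAt (fun p : E n × ℝ => Φ p.1 (t / 2 + (p.2 - t / 2))) (x, t) :=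
    ContinuousAt.comp (f := fun p : E n × ℝ => (p.1, p.2 - t / 2)) (x := (x, t)) h2 (by fun_prop)
  have e : (fun p : E n × ℝ => Φ p.1 (t / 2 + (p.2 - t / 2))) = fun p => Φ p.1 p.2 := by
    ext p; congr 1; ring
  rw [e] at h3
  exact h3.continuousWithinAt

lemma init_tendsto {T : ℝ} (hT : 0 < T) {u₀ : E n → ℝ} {u V : E n → ℝ → ℝ}
    (hV : ContinuousOn (fun p : E n × ℝ => V p.1 p.2) (univ ×ˢ Ico 0 T)) (hV0 : ∀ x, V x 0 = u₀ x)
    (huV : ∀ x, ∀ t ∈ Ioo 0 T, u x t = V x t) (K : Set (E n)) (hK : IsCompact K) :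
    Tendsto (fun t => ∫ x in K, |u x t - u₀ x|) (𝓝[>] (0 : ℝ)) (𝓝 0) := by
  have hT2 : (0 : ℝ) < T / 2 := by linarith
  have hVc0 : Continuous u₀ := by
    have : u₀ = fun x => V x 0 := by ext x; exact (hV0 x).symm
    rw [this, ← continuousOn_univ]
    exact hV.comp (f := fun y : E n => (y, (0 : ℝ))) (by fun_prop) (fun y _ => ⟨mem_univ _, le_refl _, hT⟩)
  have hW : ContinuousOn (fun p : E n × ℝ => V p.1 p.2 - u₀ p.1) (K ×ˢ Icc 0 (T / 2)) := by
    refine (hV.mono ?_).sub (by fun_prop)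
    exact prod_mono (subset_univ _) (fun t ht => ⟨ht.1, by linarith [ht.2]⟩)
  obtain ⟨M, hM⟩ := (hK.prod isCompact_Icc).exists_bound_of_continuousOn hW
  have hmem : Ioo 0 (T / 2) ∈ 𝓝[>] (0 : ℝ) := Ioo_mem_nhdsGT hT2
  have hconst : IntegrableOn (fun _ : E n => M) K := by
    rw [integrableOn_const_iff]; right; exact hK.measure_lt_top
  have := tendsto_integral_filter_of_dominated_convergence (μ := volume.restrict K) (l := 𝓝[>] (0 : ℝ))
    (F := fun t x => |u x t - u₀ x|) (f := fun _ => (0 : ℝ)) (fun _ => M) ?_ ?_ hconst ?_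
  · simpa using this
  · filter_upwards [hmem] with t ht
    have e : (fun x => |u x t - u₀ x|) = fun x => |V x t - u₀ x| := by
      ext x; rw [huV x t ⟨ht.1, by linarith [ht.2]⟩]
    rw [e]
    have hc : Continuous (fun x => V x t) := by
      rw [← continuousOn_univ]
      exact hV.comp (f := fun y : E n => (y, t)) (by fun_prop)
        (fun y _ => ⟨mem_univ _, ht.1.le, by have := ht.2; simp only; linarith⟩)
    exact (hc.sub hVc0).abs.aestronglyMeasurable
  · filter_upwards [hmem] with t ht
    refine (ae_restrict_iff' hK.measurableSet).2 (Eventually.of_forall fun x hx => ?_)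
    rw [huV x t ⟨ht.1, by linarith [ht.2]⟩, norm_abs_eq_norm]
    exact hM (x, t) ⟨hx, ht.1.le, ht.2.le⟩
  · refine Eventually.of_forall fun x => ?_
    have hc : ContinuousWithinAt (fun t => V x t) (Ico 0 T) 0 := by
      refine (hV.comp (f := fun t : ℝ => (x, t)) (s := Ico 0 T) (by fun_prop) (fun t ht => ⟨mem_univ _, ht⟩)) 0 ⟨le_refl _, hT⟩
    have hc2 : Tendsto (fun t => V x t) (𝓝[>] 0) (𝓝 (u₀ x)) := by
      rw [← hV0 x]
      have := hc.mono (Ioo_subset_Ico_self)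
      rw [ContinuousWithinAt, nhdsWithin_Ioo_eq_nhdsGT hT] at this
      exact this
    have hc3 : Tendsto (fun t => |V x t - u₀ x|) (𝓝[>] 0) (𝓝 0) := by
      have := (hc2.sub_const (u₀ x)).abs
      simpa using this
    refine hc3.congr' ?_
    filter_upwards [hmem] with t ht
    rw [huV x t ⟨ht.1, by linarith [ht.2]⟩]

theorem reg_thm {ν a T c C₀ : ℝ} {u₀ : E n → ℝ} {u : E n → ℝ → ℝ} (hν : 0 < ν) (ha : 0 < a) (hT : 0 < T)
    (haT : 128 * a * T ≤ 1) (hc : 0 < c) (hu₀ : Gs C₀ a u₀)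
    (huc : ContinuousOn (fun p : E n × ℝ => u p.1 p.2) (univ ×ˢ Ioo 0 T))
    (hlb : ∀ x, ∀ t ∈ Ioo 0 T, c * (1 + ‖x‖ ^ 2) ^ (-(1 / (1 + ν))) ≤ u x t)
    (hrep : ∀ x, ∀ t ∈ Ioo 0 T, u x t = PA (√t) u₀ x - SS (fun y s => u y s ^ (-ν)) x t) :
    IsCauchySol n ν T u₀ u := by
  have hK := KK_pos (n := n)
  have haT0 := mul_pos ha hT
  have haT' : 16 * a * T ≤ 1 := by linarith
  have hpos : ∀ x, ∀ t ∈ Ioo 0 T, 0 < u x t := by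
    intro x t ht
    have : 0 < c * (1 + ‖x‖ ^ 2) ^ (-(1 / (1 + ν))) := by positivity
    exact this.trans_le (hlb x t ht)
  set f : E n → ℝ → ℝ := fun y s => u y s ^ (-ν) with hfdef
  obtain ⟨Cf, hf⟩ : ∃ Cf, Gr T Cf a f := ⟨_, nl_gr hν hc ha huc hlb hν.le (by linarith)⟩
  obtain ⟨Cg, hg⟩ : ∃ Cg, Gr T Cg a (fun y s => u y s ^ (-(1 + ν))) :=
    ⟨_, nl_gr hν hc ha huc hlb (by linarith) le_rfl⟩
  have hC₀ := hu₀.nn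
  have hCf := hf.nn
  have hCg := hg.nn
  -- growth of u
  have hug : ∀ x, ∀ t ∈ Ioo 0 T, ‖u x t‖ ≤ (KK n * C₀ + KK n * Cf * T) * Real.exp (2 * a * ‖x‖ ^ 2) := by
    intro x t ht
    rw [hrep x t ht, add_mul]
    exact (norm_sub_le _ _).trans (add_le_add (AA_norm_le one_bd ha.le (sq_sqrt_le ha.le haT' ht.1.le ht.2.le) hu₀.bd x)
      (SS_norm_le hT.le ha.le haT' hf ht.2.le x))
  -- gradient
  set u' : E n → ℝ → E n →L[ℝ] ℝ := fun x t => DA (√t) u₀ x - NN (fun x τ s => DA (√τ) (fun y => f y s) x) x t with hu'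
  have hud : ∀ x, ∀ t ∈ Ioo 0 T, HasFDerivAt (fun y => u y t) (u' x t) x := by
    intro x t ht
    have h32 : ∀ τ ∈ Ioo 0 T, 32 * a * (√τ) ^ 2 ≤ 1 := by
      intro τ hτ
      rw [Real.sq_sqrt hτ.1.le]
      nlinarith [mul_le_mul_of_nonneg_left hτ.2.le ha.le]
    have e : (fun y => u y t) = fun y => PA (√t) u₀ y - SS f y t := by ext y; exact hrep y t ht
    rw [e]
    refine (PA_hasFDerivAt_kernel (Real.sqrt_pos.2 ht.1) ha.le (h32 t ht) hu₀.cont hu₀.bd x).sub ?_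
    refine (PA_adm ha.le haT' hf).hasFDerivAt (DA_adm ha.le haT' hf) ?_ (one_integrable T)
      (sqrt_inv_integrable T) (fun τ _ => by positivity) (by positivity) (by positivity) ht.2.le x
    intro x τ hτ s hs
    exact PA_hasFDerivAt_kernel (Real.sqrt_pos.2 hτ.1) ha.le (h32 τ hτ) (hf.slice hs).cont (hf.slice hs).bd x
  have hu'c : ContinuousOn (fun p : E n × ℝ => u' p.1 p.2) (univ ×ˢ Ioo 0 T) := by
    refine (adm_contOn (J := fun x τ => DA (√τ) u₀ x) (DA_adm (T := T) ha.le haT' (const_gr hu₀))).sub ?_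
    exact ((DA_adm (T := T) ha.le haT' hf).continuousOn (sqrt_inv_integrable T) (fun τ _ => by positivity)
      (by positivity) (by positivity)).mono (prod_mono_right (fun t ht => ht.2.le))
  set Q : ℝ := ∫ τ in Ioo 0 T, (√τ)⁻¹ with hQ
  have hQ0 : 0 ≤ Q := setIntegral_nonneg measurableSet_Ioo (fun τ _ => by positivity)
  have hu'g : ∀ t₁ ∈ Ioo 0 T, ∀ x, ∀ t ∈ Ico t₁ T, ‖u' x t‖ ≤
      ((n * (KK n * C₀)) * (√t₁)⁻¹ + n * (KK n * Cf) * Q) * Real.exp (2 * a * ‖x‖ ^ 2) := by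
    intro t₁ ht₁ x t ht
    have ht0 : 0 < t := ht₁.1.trans_le ht.1
    rw [add_mul]
    refine (norm_sub_le _ _).trans (add_le_add ?_ ?_)
    · refine (DA_norm_le (Real.sqrt_pos.2 ht0) ha.le (sq_sqrt_le ha.le haT' ht0.le ht.2.le) hu₀ x).trans ?_
      have h1 : 0 < √t₁ := Real.sqrt_pos.2 ht₁.1
      have h2 : (√t)⁻¹ ≤ (√t₁)⁻¹ := by
        gcongr; exact ht.1
      calc _ ≤ ↑n * (KK n * C₀) * rexp (2 * a * ‖x‖ ^ 2) * (√t₁)⁻¹ := by gcongr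
        _ = _ := by ring
    · exact (DA_adm (T := T) ha.le haT' hf).norm_le (sqrt_inv_integrable T) (fun τ _ => by positivity)
        (by positivity) ht.2.le x
  set f' : E n → ℝ → E n →L[ℝ] ℝ := fun x t => (-ν * u x t ^ (-(1 + ν))) • u' x t with hf'
  have hfd : ∀ x, ∀ t ∈ Ioo 0 T, HasFDerivAt (fun y => f y t) (f' x t) x := by
    intro x t ht
    have h1 := (hud x t ht).rpow_const (p := -ν) (Or.inl (hpos x t ht).ne')
    refine h1.congr_fderiv ?_
    simp only [hf']
    congr 3; ring
  have hf'c : ContinuousOn (fun p : E n × ℝ => f' p.1 p.2) (univ ×ˢ Ioo 0 T) :=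
    (continuousOn_const.mul hg.cont).smul hu'c
  -- main claim
  have main : ∀ t₁ ∈ Ioo 0 T, IsC21 (univ ×ˢ Ioo 0 (T - t₁)) (fun x s => u x (t₁ + s)) ∧
      ∀ x, ∀ s ∈ Ioo 0 (T - t₁), deriv (fun s => u x (t₁ + s)) s = lap (fun y => u y (t₁ + s)) x - f x (t₁ + s) := by
    intro t₁ ht₁
    set M : ℝ := (n * (KK n * C₀)) * (√t₁)⁻¹ + n * (KK n * Cf) * Q with hM
    have hM0 : 0 ≤ M := by positivity
    have hexp : ∀ x : E n, Real.exp (2 * a * ‖x‖ ^ 2) ≤ Real.exp (3 * a * ‖x‖ ^ 2) := fun x => by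
      gcongr; norm_num
    have hshift : ∀ s ∈ Ioo 0 (T - t₁), t₁ + s ∈ Ioo 0 T := fun s hs =>
      ⟨by linarith [hs.1, ht₁.1], by linarith [hs.2]⟩
    have hmaps : MapsTo (fun p : E n × ℝ => (p.1, t₁ + p.2)) (univ ×ˢ Ioo 0 (T - t₁)) (univ ×ˢ Ioo 0 T) :=
      fun p hp => ⟨mem_univ _, hshift _ hp.2⟩
    refine reg_core (a := 3 * a) (h := fun y => u y t₁) (h' := fun y => u' y t₁)
      (f := fun y s => f y (t₁ + s)) (f' := fun y s => f' y (t₁ + s))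
      (Ch := KK n * C₀ + KK n * Cf * T) (Ch' := M) (Cf := Cf) (Cf' := ν * Cg * M)
      (by positivity) (by nlinarith [mul_pos ha ht₁.1]) ?_ ?_ ?_ ?_ ?_ ?_ ?_
    · constructor
      · rw [← continuousOn_univ]
        exact huc.comp (f := fun y : E n => (y, t₁)) (by fun_prop) (fun y _ => ⟨mem_univ _, ht₁⟩)
      · intro x
        refine (hug x t₁ ht₁).trans ?_
        gcongr ?_ * ?_
        exact hexp x
    · constructor
      · rw [← continuousOn_univ]
        exact hu'c.comp (f := fun y : E n => (y, t₁)) (by fun_prop) (fun y _ => ⟨mem_univ _, ht₁⟩)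
      · intro x
        refine (hu'g t₁ ht₁ x t₁ ⟨le_rfl, ht₁.2⟩).trans ?_
        gcongr ?_ * ?_
        exact hexp x
    · intro x; exact hud x t₁ ht₁
    · refine ⟨hCf, hf.cont.comp (f := fun p : E n × ℝ => (p.1, t₁ + p.2)) (by fun_prop) hmaps, ?_⟩
      intro x s hs
      refine (hf.bd x _ (hshift s hs)).trans ?_
      gcongr
      linarith
    · refine ⟨by positivity, hf'c.comp (f := fun p : E n × ℝ => (p.1, t₁ + p.2)) (by fun_prop) hmaps, ?_⟩
      intro x s hs
      have hm := hshift s hs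
      simp only [hf']
      rw [norm_smul, norm_mul, norm_neg, Real.norm_of_nonneg hν.le]
      have e1 := hg.bd x _ hm
      have e2 := hu'g t₁ ht₁ x (t₁ + s) ⟨by linarith [hs.1], hm.2⟩
      calc _ ≤ ν * (Cg * Real.exp (a * ‖x‖ ^ 2)) * (M * Real.exp (2 * a * ‖x‖ ^ 2)) := by gcongr
        _ = ν * Cg * M * (Real.exp (a * ‖x‖ ^ 2) * Real.exp (2 * a * ‖x‖ ^ 2)) := by ring
        _ = _ := by rw [← Real.exp_add]; congr 2; ring
    · intro x s hs; exact hfd x _ (hshift s hs)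
    · intro x s hs
      rw [restart ha.le (by nlinarith) hu₀ hf ht₁.1 hs.1 (by linarith [hs.2]) (fun y => hrep y t₁ ht₁) x]
      exact hrep x _ (hshift s hs)
  refine ⟨hpos, ⟨huc, ?_, ?_, ?_⟩, ?_, ?_, ?_⟩
  · refine shift_contOn (Φ := fun x t => deriv (u x) t) fun t₁ ht₁ => ?_
    refine (main t₁ ht₁).1.cont_t.congr ?_
    rintro ⟨x, s⟩ _
    simp only
    rw [deriv_comp_const_add]
  · intro i
    exact shift_contOn (Φ := fun x t => fderiv ℝ (fun y => u y t) x (EuclideanSpace.single i (1 : ℝ)))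
      fun t₁ ht₁ => (main t₁ ht₁).1.cont_x i
  · intro i j
    exact shift_contOn (Φ := fun x t => pd2 (fun y => u y t) i j x)
      fun t₁ ht₁ => (main t₁ ht₁).1.cont_xx i j
  · intro x t ht
    have h1 := (main (t / 2) ⟨by linarith [ht.1], by linarith [ht.1, ht.2]⟩).2 x (t / 2)
      ⟨by linarith [ht.1], by linarith [ht.2]⟩
    rw [deriv_comp_const_add] at h1
    simpa using h1
  · refine init_tendsto hT (V := fun x t => PA (√t) u₀ x - SS f x t) ?_ ?_ hrep
    · exact ((PA_sqrt_cont ha.le haT' hu₀).mono (prod_mono_right Ico_subset_Icc_self)).sub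
        ((SS_cont ha.le haT' hf).mono (prod_mono_right (fun t ht => ht.2.le)))
    · intro x
      simp only [Real.sqrt_zero]
      rw [PA_zero]
      simp [SS, NN]
  · intro δ hδ
    set B := KK n * C₀ + KK n * Cf * T with hB
    have hB0 : 0 ≤ B := by positivity
    refine ⟨c, B + 2 * a, hc, by positivity, fun x t ht => ?_⟩
    have ht' : t ∈ Ioo 0 T := ⟨ht.1, by linarith [ht.2, hδ.1]⟩
    refine ⟨hlb x t ht', ?_⟩
    refine (le_abs_self _).trans ((hug x t ht').trans ?_)
    gcongr
    · linarith
    · linarith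

end regthm

section existthm
variable {n : ℕ}

lemma heatRepr_iff {ν T : ℝ} {u₀ : E n → ℝ} {u : E n → ℝ → ℝ} :
    HeatRepr n ν T u₀ u ↔
      ∀ x, ∀ t ∈ Ioo 0 T, u x t = PA (√t) u₀ x - SS (fun y s => u y s ^ (-ν)) x t := by
  unfold HeatRepr
  refine forall_congr' fun x => forall_congr' fun t => forall_congr' fun ht => ?_
  rw [heatKernel_conv ht.1, SS, NN_shift]
  have : ∫ s in Ioo (0 : ℝ) t, ∫ y : E n, heatKernel n (t - s) (x - y) * u y s ^ (-ν) =
      ∫ s in Ioo (0 : ℝ) t, PA (√(t - s)) (fun y => u y s ^ (-ν)) x := by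
    refine setIntegral_congr_fun measurableSet_Ioo fun s hs => ?_
    exact heatKernel_conv (sub_pos.2 hs.2) (fun y => u y s ^ (-ν)) x
  rw [this]

lemma rpow_neg_lip {ν m r s : ℝ} (hν : 0 < ν) (hm : 0 < m) (hr : m ≤ r) (hs : m ≤ s) :
    |r ^ (-ν) - s ^ (-ν)| ≤ ν * m ^ (-(1 + ν)) * |r - s| := by
  have h := Convex.norm_image_sub_le_of_norm_hasDerivWithin_le (f := fun r : ℝ => r ^ (-ν))
    (f' := fun r : ℝ => (-ν) * r ^ (-ν - 1)) (C := ν * m ^ (-(1 + ν))) (s := Ici m) (x := s) (y := r)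
    ?_ ?_ (convex_Ici m) hs hr
  · simpa [Real.norm_eq_abs] using h
  · intro x hx
    have hx0 : 0 < x := hm.trans_le hx
    exact (Real.hasDerivAt_rpow_const (Or.inl hx0.ne')).hasDerivWithinAt
  · intro x hx
    have hx0 : 0 < x := hm.trans_le hx
    have h1 : 0 < x ^ (-ν - 1) := by positivity
    rw [norm_mul, norm_neg, Real.norm_of_nonneg hν.le, Real.norm_of_nonneg h1.le]
    have e : -ν - 1 = -(1 + ν) := by ring
    rw [e]
    gcongr ν * ?_
    exact Real.rpow_le_rpow_of_nonpos hm hx (by linarith)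

lemma SS_le {T : ℝ} {f : E n → ℝ → ℝ} {φ : ℝ → ℝ} (hφ : Continuous φ)
    (hf : ∀ y, ∀ s ∈ Ioo 0 T, ‖f y s‖ ≤ φ s) {t : ℝ} (ht : t ≤ T) (x : E n) :
    ‖SS f x t‖ ≤ ∫ s in Ioo 0 t, φ s := by
  rw [SS, NN_shift]
  refine norm_integral_le_of_norm_le ?_ ?_
  · exact (hφ.integrableOn_Icc (a := 0) (b := t)).mono_set Ioo_subset_Icc_self
  · refine (ae_restrict_iff' measurableSet_Ioo).2 (Eventually.of_forall fun s hs => ?_)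
    have h1 := PA_norm_le_of_le (r := √(t - s)) (g := fun y => f y s) (h := fun _ => φ s) x
      (by simpa using gk_integrable.mul_const (φ s)) (fun y => hf y s ⟨hs.1, hs.2.trans_le ht⟩)
    rwa [PA_const] at h1

lemma SS_sub {T a C C' : ℝ} {f g : E n → ℝ → ℝ} (ha : 0 ≤ a) (haT : 16 * a * T ≤ 1) (hf : Gr T C a f)
    (hg : Gr T C' a g) {t : ℝ} (ht : t ≤ T) (x : E n) :
    SS (fun y s => f y s - g y s) x t = SS f x t - SS g x t := by
  unfold SS NN
  rw [← integral_sub ((PA_adm ha haT hf).integrableOn (one_integrable T) ht x)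
    ((PA_adm ha haT hg).integrableOn (one_integrable T) ht x)]
  refine setIntegral_congr_fun measurableSet_Ioo fun τ hτ => ?_
  have hs : t - τ ∈ Ioo 0 T := ⟨sub_pos.2 hτ.2, by linarith [hτ.1]⟩
  exact PA_sub ha (sq_sqrt_le ha haT hτ.1.le (hτ.2.le.trans ht)) (hf.slice hs).cont (hf.slice hs).bd
    (hg.slice hs).cont (hg.slice hs).bd x

lemma nl_gr0 {ν m T : ℝ} (hν : 0 < ν) (hm : 0 < m) {u : E n → ℝ → ℝ}
    (hc : ContinuousOn (fun p : E n × ℝ => u p.1 p.2) (univ ×ˢ Icc 0 T))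
    (hl : ∀ x, ∀ t ∈ Icc 0 T, m ≤ u x t) : Gr T (m ^ (-ν)) 0 (fun y s => u y s ^ (-ν)) where
  nn := by positivity
  cont := by
    refine (hc.mono (prod_mono_right Ioo_subset_Icc_self)).rpow_const ?_
    rintro ⟨x, t⟩ ⟨_, ht⟩
    exact Or.inl (hm.trans_le (hl x t (Ioo_subset_Icc_self ht))).ne'
  bd := fun x t ht => by
    have h1 := hl x t (Ioo_subset_Icc_self ht)
    have : 0 < u x t := hm.trans_le h1
    rw [Real.norm_of_nonneg (by positivity)]
    simpa using Real.rpow_le_rpow_of_nonpos hm h1 (by linarith)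

/-- Picard iterates -/
def Pic (ν : ℝ) (w₀ : E n → ℝ) : ℕ → E n → ℝ → ℝ
  | 0 => fun x t => PA (√t) w₀ x
  | k + 1 => fun x t => PA (√t) w₀ x - SS (fun y s => Pic ν w₀ k y s ^ (-ν)) x t

theorem exist_thm {ν a T ε C₀ : ℝ} {w₀ : E n → ℝ} (hν : 0 < ν) (ha : 0 ≤ a) (hT : 0 < T)
    (haT : 16 * a * T ≤ 1) (hε : 0 < ε) (hw₀ : Gs C₀ a w₀) (hlow : ∀ x, ε ≤ w₀ x)
    (hTε : T ≤ (ε / 2) ^ (1 + ν)) :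
    ∃ w : E n → ℝ → ℝ, ContinuousOn (fun p : E n × ℝ => w p.1 p.2) (univ ×ˢ Icc 0 T) ∧
      (∀ x, w x 0 = w₀ x) ∧ (∀ x, ∀ t ∈ Icc 0 T, ε / 2 ≤ w x t) ∧
      ∀ x, ∀ t ∈ Icc 0 T, w x t = PA (√t) w₀ x - SS (fun y s => w y s ^ (-ν)) x t := by
  set m := ε / 2 with hm
  have hm0 : 0 < m := by positivity
  have hmn : 0 < m ^ (-ν) := by positivity
  have h00 : 16 * (0 : ℝ) * T ≤ 1 := by norm_num
  have hTm : T * m ^ (-ν) ≤ m := by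
    calc T * m ^ (-ν) ≤ m ^ (1 + ν) * m ^ (-ν) := by gcongr
      _ = m := by rw [← Real.rpow_add hm0]; simp
  have hH : ∀ x, ∀ t ∈ Icc 0 T, ε ≤ PA (√t) w₀ x := by
    intro x t ht
    have h1 := PA_mono (C := ε) ha (sq_sqrt_le ha haT ht.1 ht.2) (g := fun _ => ε) continuous_const
      (fun x => by
        rw [Real.norm_of_nonneg hε.le]
        have : 1 ≤ Real.exp (a * ‖x‖ ^ 2) := Real.one_le_exp (by positivity)
        nlinarith) hw₀.cont hw₀.bd hlow x
    rwa [PA_const] at h1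
  have hSb : ∀ f : E n → ℝ → ℝ, (∀ y, ∀ s ∈ Ioo 0 T, ‖f y s‖ ≤ m ^ (-ν)) → ∀ x, ∀ t ∈ Icc 0 T, ‖SS f x t‖ ≤ m := by
    intro f hf x t ht
    refine (SS_le (φ := fun _ => m ^ (-ν)) continuous_const hf ht.2 x).trans ?_
    have : ∫ s in Ioo 0 t, m ^ (-ν) = t * m ^ (-ν) := by simp [ht.1]
    rw [this]
    exact le_trans (by gcongr; exact ht.2) hTm
  have hstep : ∀ u : E n → ℝ → ℝ, ContinuousOn (fun p : E n × ℝ => u p.1 p.2) (univ ×ˢ Icc 0 T) →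
      (∀ x, ∀ t ∈ Icc 0 T, m ≤ u x t) →
      ContinuousOn (fun p : E n × ℝ => PA (√p.2) w₀ p.1 - SS (fun y s => u y s ^ (-ν)) p.1 p.2) (univ ×ˢ Icc 0 T) ∧
      ∀ x, ∀ t ∈ Icc 0 T, m ≤ PA (√t) w₀ x - SS (fun y s => u y s ^ (-ν)) x t := by
    intro u hc hl
    have hg := nl_gr0 hν hm0 hc hl
    constructor
    · exact (PA_sqrt_cont ha haT hw₀).sub ((SS_cont le_rfl h00 hg).mono (prod_mono_right Icc_subset_Iic_self))
    · intro x t ht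
      have h1 := hSb _ (fun y s hs => by simpa using hg.bd y s hs) x t ht
      have h2 := hH x t ht
      have h3 := (abs_le.1 (Real.norm_eq_abs _ ▸ h1)).2
      linarith
  have hP : ∀ k, ContinuousOn (fun p : E n × ℝ => Pic ν w₀ k p.1 p.2) (univ ×ˢ Icc 0 T) ∧
      (∀ x, ∀ t ∈ Icc 0 T, m ≤ Pic ν w₀ k x t) := by
    intro k
    induction k with
    | zero =>
      refine ⟨PA_sqrt_cont ha haT hw₀, fun x t ht => ?_⟩
      have := hH x t ht
      show m ≤ PA (√t) w₀ x
      linarith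
    | succ k ih => exact hstep _ ih.1 ih.2
  set L := ν * m ^ (-(1 + ν)) with hL
  have hL0 : 0 < L := by positivity
  have hlip : ∀ (u v : E n → ℝ → ℝ) (B : ℝ → ℝ), Continuous B →
      ContinuousOn (fun p : E n × ℝ => u p.1 p.2) (univ ×ˢ Icc 0 T) →
      (∀ x, ∀ t ∈ Icc 0 T, m ≤ u x t) →
      ContinuousOn (fun p : E n × ℝ => v p.1 p.2) (univ ×ˢ Icc 0 T) →
      (∀ x, ∀ t ∈ Icc 0 T, m ≤ v x t) → (∀ x, ∀ t ∈ Icc 0 T, |u x t - v x t| ≤ B t) →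
      ∀ x, ∀ t ∈ Icc 0 T, |SS (fun y s => u y s ^ (-ν)) x t - SS (fun y s => v y s ^ (-ν)) x t| ≤
        ∫ s in Ioo 0 t, L * B s := by
    intro u v B hB huc hul hvc hvl huv x t ht
    rw [← SS_sub le_rfl h00 (nl_gr0 hν hm0 huc hul) (nl_gr0 hν hm0 hvc hvl) ht.2]
    refine SS_le (T := T) (by fun_prop) (fun y s hs => ?_) ht.2 x
    have hs' := Ioo_subset_Icc_self hs
    refine (rpow_neg_lip hν hm0 (hul y s hs') (hvl y s hs')).trans ?_
    gcongr
    exact huv y s hs'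
  have hexp : ∀ A t : ℝ, 0 ≤ A → 0 ≤ t → ∫ s in Ioo 0 t, L * (A * Real.exp (2 * L * s)) ≤ A / 2 * Real.exp (2 * L * t) := by
    intro A t hA ht
    rw [integral_Ioo_eq _ ht]
    have : ∫ s in (0:ℝ)..t, L * (A * Real.exp (2 * L * s)) = A / 2 * Real.exp (2 * L * t) - A / 2 * Real.exp (2 * L * 0) := by
      refine intervalIntegral.integral_eq_sub_of_hasDerivAt (f := fun s => A / 2 * Real.exp (2 * L * s)) (fun s _ => ?_) ?_
      · have := (((hasDerivAt_id s).const_mul (2 * L)).exp).const_mul (A / 2)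
        exact HasDerivAt.congr_deriv this (by simp only [id]; ring)
      · exact Continuous.intervalIntegrable (by fun_prop) _ _
    rw [this]
    have : 0 < Real.exp (2 * L * 0) := Real.exp_pos _
    nlinarith
  have hdiff : ∀ k, ∀ x, ∀ t ∈ Icc 0 T, |Pic ν w₀ (k + 1) x t - Pic ν w₀ k x t| ≤ m * (1 / 2) ^ k * Real.exp (2 * L * t) := by
    intro k
    induction k with
    | zero =>
      intro x t ht
      show |(PA (√t) w₀ x - SS (fun y s => Pic ν w₀ 0 y s ^ (-ν)) x t) - PA (√t) w₀ x| ≤ _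
      have h1 := hSb _ (fun y s hs => by simpa using (nl_gr0 hν hm0 (hP 0).1 (hP 0).2).bd y s hs) x t ht
      rw [sub_sub_cancel_left, abs_neg]
      refine h1.trans ?_
      have : 1 ≤ Real.exp (2 * L * t) := Real.one_le_exp (mul_nonneg (by positivity) ht.1)
      simp; nlinarith
    | succ k ih =>
      intro x t ht
      show |(PA (√t) w₀ x - SS (fun y s => Pic ν w₀ (k+1) y s ^ (-ν)) x t) - (PA (√t) w₀ x - SS (fun y s => Pic ν w₀ k y s ^ (-ν)) x t)| ≤ _
      rw [sub_sub_sub_cancel_left, abs_sub_comm]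
      have h1 := hlip _ _ (fun t => m * (1 / 2) ^ k * Real.exp (2 * L * t)) (by fun_prop) (hP (k+1)).1 (hP (k+1)).2 (hP k).1 (hP k).2 ih x t ht
      refine h1.trans ((hexp _ t (by positivity) ht.1).trans (le_of_eq ?_))
      rw [pow_succ]; ring
  set D := m * Real.exp (2 * L * T) with hD
  have hgeo : ∀ x, ∀ t ∈ Icc 0 T, ∀ k, dist (Pic ν w₀ k x t) (Pic ν w₀ (k + 1) x t) ≤ D * (1 / 2) ^ k := by
    intro x t ht k
    rw [dist_comm, Real.dist_eq]
    refine (hdiff k x t ht).trans ?_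
    rw [hD]
    have : Real.exp (2 * L * t) ≤ Real.exp (2 * L * T) := by
      apply Real.exp_le_exp.2; have := ht.2; gcongr
    calc _ ≤ m * (1 / 2) ^ k * Real.exp (2 * L * T) := by gcongr
      _ = _ := by ring
  set w : E n → ℝ → ℝ := fun x t => limUnder atTop (fun k => Pic ν w₀ k x t) with hw
  have hlim : ∀ x, ∀ t ∈ Icc 0 T, Tendsto (fun k => Pic ν w₀ k x t) atTop (𝓝 (w x t)) := by
    intro x t ht
    exact (cauchySeq_of_le_geometric _ _ (by norm_num) (hgeo x t ht)).tendsto_limUnder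
  have hrate : ∀ k, ∀ x, ∀ t ∈ Icc 0 T, |Pic ν w₀ k x t - w x t| ≤ 2 * D * (1 / 2) ^ k := by
    intro k x t ht
    have := dist_le_of_le_geometric_of_tendsto _ _ (by norm_num) (hgeo x t ht) (hlim x t ht) k
    rw [Real.dist_eq] at this
    refine this.trans (le_of_eq ?_); ring
  have hz : ∀ B : ℝ, Tendsto (fun k : ℕ => B * (1 / 2 : ℝ) ^ k) atTop (𝓝 0) := by
    intro B
    simpa using (tendsto_pow_atTop_nhds_zero_of_lt_one (r := (1/2:ℝ)) (by norm_num) (by norm_num)).const_mul B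
  have hwc : ContinuousOn (fun p : E n × ℝ => w p.1 p.2) (univ ×ˢ Icc 0 T) := by
    refine TendstoUniformlyOn.continuousOn (F := fun k (p : E n × ℝ) => Pic ν w₀ k p.1 p.2) (p := atTop) ?_
      (Eventually.of_forall fun k => (hP k).1).frequently
    rw [Metric.tendstoUniformlyOn_iff]
    intro η hη
    filter_upwards [(hz (2 * D)).eventually (gt_mem_nhds hη)] with k hk p hp
    rw [dist_comm, Real.dist_eq]
    exact (hrate k p.1 p.2 hp.2).trans_lt hk
  have hwl : ∀ x, ∀ t ∈ Icc 0 T, m ≤ w x t := fun x t ht =>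
    ge_of_tendsto' (hlim x t ht) (fun k => (hP k).2 x t ht)
  have hrep : ∀ x, ∀ t ∈ Icc 0 T, w x t = PA (√t) w₀ x - SS (fun y s => w y s ^ (-ν)) x t := by
    intro x t ht
    have h1 : Tendsto (fun k => Pic ν w₀ (k + 1) x t) atTop (𝓝 (w x t)) := (hlim x t ht).comp (tendsto_add_atTop_nat 1)
    refine tendsto_nhds_unique h1 ?_
    show Tendsto (fun k => PA (√t) w₀ x - SS (fun y s => Pic ν w₀ k y s ^ (-ν)) x t) atTop _
    refine Tendsto.const_sub _ ?_
    rw [tendsto_iff_dist_tendsto_zero]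
    refine squeeze_zero (fun _ => dist_nonneg) (fun k => ?_) (hz (t * (L * (2 * D))))
    rw [Real.dist_eq]
    refine (hlip _ _ (fun _ => 2 * D * (1 / 2) ^ k) continuous_const (hP k).1 (hP k).2 hwc hwl (hrate k) x t ht).trans (le_of_eq ?_)
    simp [ht.1]; ring
  refine ⟨w, hwc, fun x => ?_, hwl, hrep⟩
  rw [hrep x 0 ⟨le_rfl, hT.le⟩, Real.sqrt_zero, PA_zero]
  simp [SS, NN]

end existthm

section uniqthm
variable {n : ℕ}

lemma norm_sub_sq_le' {κ τ : ℝ} (hκ : 0 < κ) (hτ : 0 ≤ τ) (x z : E n) :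
    ‖x - √τ • z‖ ^ 2 ≤ (1 + κ * τ) * ‖x‖ ^ 2 + (τ + 1 / κ) * ‖z‖ ^ 2 := by
  have h : ‖x - √τ • z‖ ≤ ‖x‖ + √τ * ‖z‖ := by
    refine (norm_sub_le _ _).trans ?_
    rw [norm_smul, Real.norm_of_nonneg (Real.sqrt_nonneg _)]
  have h2 : ‖x - √τ • z‖ ^ 2 ≤ (‖x‖ + √τ * ‖z‖) ^ 2 := by gcongr
  refine h2.trans ?_
  have hs := Real.sq_sqrt hτ
  have h3 : 0 ≤ (κ * √τ * ‖x‖ - ‖z‖) ^ 2 / κ := by positivity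
  have h4 : (κ * √τ * ‖x‖ - ‖z‖) ^ 2 / κ = κ * (√τ ^ 2) * ‖x‖ ^ 2 - 2 * √τ * ‖x‖ * ‖z‖ + 1 / κ * ‖z‖ ^ 2 := by
    field_simp
    ring
  rw [h4, hs] at h3
  have h5 : (‖x‖ + √τ * ‖z‖) ^ 2 = ‖x‖ ^ 2 + 2 * √τ * ‖x‖ * ‖z‖ + (√τ ^ 2) * ‖z‖ ^ 2 := by ring
  rw [h5, hs]
  nlinarith

lemma uniq_pt {κ τ b D : ℝ} (hκ : 16 ≤ κ) (hτ : 0 ≤ τ) (hτκ : τ ≤ 1 / (4 * κ)) (hb : 0 ≤ b) (hb1 : b ≤ 1)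
    (hD : 0 ≤ D) {g : E n → ℝ} (hg : ∀ y, ‖g y‖ ≤ D * (1 + ‖y‖ ^ 2) * Real.exp (b * ‖y‖ ^ 2)) (x : E n) :
    ‖PA (√τ) g x‖ ≤ 2 * D * KK n * ((1 + ‖x‖ ^ 2) * Real.exp ((b + κ * τ) * ‖x‖ ^ 2)) := by
  have hκ0 : 0 < κ := by linarith
  have hτ1 : τ ≤ 1 / 64 := hτκ.trans (by
    apply one_div_le_one_div_of_le <;> linarith)
  have hk16 : 1 / κ ≤ 1 / 16 := one_div_le_one_div_of_le (by norm_num) hκ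
  unfold PA AA
  have : 2 * D * KK n * ((1 + ‖x‖ ^ 2) * Real.exp ((b + κ * τ) * ‖x‖ ^ 2)) =
      ∫ z : E n, (2 * D * ((1 + ‖x‖ ^ 2) * Real.exp ((b + κ * τ) * ‖x‖ ^ 2))) * wk n z := by
    rw [integral_const_mul, KK]; ring
  rw [this]
  refine norm_integral_le_of_norm_le (wk_integrable.const_mul _) (Eventually.of_forall fun z => ?_)
  have hgk := gk_pos z
  rw [mul_one, norm_smul, Real.norm_of_nonneg hgk.le]
  have h1 := hg (x - √τ • z)
  have hn := norm_sub_sq_le' hκ0 hτ x z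
  have hn2 := norm_sub_sq_le x z (√τ)
  rw [Real.sq_sqrt hτ] at hn2
  have h2 : 1 + ‖x - √τ • z‖ ^ 2 ≤ 2 * (1 + ‖x‖ ^ 2) * (1 + ‖z‖) ^ 2 := by
    have hx := sq_nonneg ‖x‖
    have hz := sq_nonneg ‖z‖
    have hz0 := norm_nonneg z
    have e1 : 1 + ‖x - √τ • z‖ ^ 2 ≤ 2 * (1 + ‖x‖ ^ 2) * (1 + ‖z‖ ^ 2) := by
      nlinarith [mul_nonneg hx hz, mul_le_mul_of_nonneg_right hτ1 hz]
    refine e1.trans ?_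
    gcongr
    nlinarith
  have h3 : Real.exp (b * ‖x - √τ • z‖ ^ 2) ≤ Real.exp ((b + κ * τ) * ‖x‖ ^ 2) * Real.exp (‖z‖ ^ 2 / 8) := by
    rw [← Real.exp_add]
    apply Real.exp_le_exp.2
    have e1 := mul_le_mul_of_nonneg_left hn hb
    refine e1.trans ?_
    have e2 : b * (κ * τ * ‖x‖ ^ 2) ≤ 1 * (κ * τ * ‖x‖ ^ 2) := by gcongr
    have e3 : b * ((τ + 1 / κ) * ‖z‖ ^ 2) ≤ 1 * ((1 / 8) * ‖z‖ ^ 2) := by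
      gcongr; linarith
    nlinarith
  calc gk n z * ‖g (x - √τ • z)‖
      ≤ gk n z * (D * (2 * (1 + ‖x‖ ^ 2) * (1 + ‖z‖) ^ 2) * (Real.exp ((b + κ * τ) * ‖x‖ ^ 2) * Real.exp (‖z‖ ^ 2 / 8))) := by
        gcongr
        refine h1.trans ?_
        gcongr
    _ = _ := by unfold wk; ring

lemma uniq_time {κ X η : ℝ} (hX : 0 ≤ X) (hκ : 0 < κ) (hη : 0 ≤ η) (hη2 : η ≤ 1 / κ) :
    ∫ τ in Ioo 0 η, (1 + X) * Real.exp (-(κ * τ) * X) ≤ 2 / κ := by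
  rw [integral_Ioo_eq _ hη]
  have hd : ∀ τ, HasDerivAt (fun τ => τ + (1 - Real.exp (-(κ * τ) * X)) / κ) (1 + X * Real.exp (-(κ * τ) * X)) τ := by
    intro τ
    have h1 : HasDerivAt (fun τ : ℝ => -(κ * τ) * X) (-(κ * 1) * X) τ :=
      ((((hasDerivAt_id τ).const_mul κ).neg).mul_const X)
    have h2 := (hasDerivAt_id τ).add (((h1.exp).const_sub 1).div_const κ)
    exact HasDerivAt.congr_deriv h2 (by field_simp)
  have hI : ∫ τ in (0:ℝ)..η, (1 + X * Real.exp (-(κ * τ) * X)) = _ :=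
    intervalIntegral.integral_eq_sub_of_hasDerivAt (fun τ _ => hd τ) (Continuous.intervalIntegrable (by fun_prop) _ _)
  have hle : ∫ τ in (0:ℝ)..η, (1 + X) * Real.exp (-(κ * τ) * X) ≤ ∫ τ in (0:ℝ)..η, (1 + X * Real.exp (-(κ * τ) * X)) := by
    refine intervalIntegral.integral_mono_on hη (Continuous.intervalIntegrable (by fun_prop) _ _)
      (Continuous.intervalIntegrable (by fun_prop) _ _) fun τ hτ => ?_
    have : Real.exp (-(κ * τ) * X) ≤ 1 := by
      apply Real.exp_le_one_iff.2
      have := mul_nonneg (mul_nonneg hκ.le hτ.1) hX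
      linarith
    linarith
  refine hle.trans ?_
  rw [hI]
  have h3 := Real.exp_pos (-(κ * η) * X)
  have h4 : (1 - Real.exp (-(κ * η) * X)) / κ ≤ 1 / κ := by gcongr; linarith
  simp only [mul_zero, neg_zero, zero_mul, Real.exp_zero, sub_self, zero_div, add_zero, sub_zero]
  have : (2 : ℝ) / κ = 1 / κ + 1 / κ := by ring
  linarith

theorem uniq_abs {T a₀ B M₀ : ℝ} {W h : E n → ℝ → ℝ} (ha0 : 0 ≤ a₀) (ha1 : a₀ ≤ 1 / 2) (hB : 0 ≤ B) (hM₀ : 0 ≤ M₀)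
    (hW : ∀ x, ∀ t ∈ Ioo 0 T, W x t = SS h x t)
    (hh : ∀ y, ∀ s ∈ Ioo 0 T, ‖h y s‖ ≤ B * (1 + ‖y‖ ^ 2) * |W y s|)
    (hM : ∀ x, ∀ t ∈ Ioo 0 T, |W x t| ≤ M₀ * Real.exp (a₀ * ‖x‖ ^ 2)) :
    ∀ x, ∀ t ∈ Ioo 0 T, W x t = 0 := by
  have hK := KK_pos (n := n)
  set κ := 16 + 8 * B * KK n with hκ
  have hBK : 0 ≤ B * KK n := by positivity
  have hκ16 : 16 ≤ κ := by nlinarith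
  have hκ0 : 0 < κ := by linarith
  set θ := 1 / (4 * κ) with hθ
  have hθ0 : 0 < θ := by positivity
  have hκθ : κ * θ = 1 / 4 := by rw [hθ]; field_simp
  have key : ∀ t₀ : ℝ, 0 ≤ t₀ → (∀ x, ∀ t ∈ Ioo 0 T, t ≤ t₀ → W x t = 0) →
      ∀ x, ∀ t ∈ Ioo 0 T, t ≤ t₀ + θ → W x t = 0 := by
    intro t₀ ht₀ hzero
    have hk : ∀ k : ℕ, ∀ x, ∀ t ∈ Ioo 0 T, t₀ < t → t ≤ t₀ + θ →
        |W x t| ≤ M₀ * (1 / 2) ^ k * Real.exp ((a₀ + 2 * κ * (t - t₀)) * ‖x‖ ^ 2) := by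
      intro k
      induction k with
      | zero =>
        intro x t ht h1 h2
        refine (hM x t ht).trans ?_
        rw [pow_zero, mul_one]
        gcongr
        have : 0 ≤ κ * (t - t₀) := mul_nonneg hκ0.le (by linarith)
        linarith
      | succ k ih =>
        intro x t ht h1 h2
        set M := M₀ * (1 / 2) ^ k with hMdef
        have hM0 : 0 ≤ M := by positivity
        rw [hW x t ht, SS, NN, ← Real.norm_eq_abs]
        have hsub : Ioo 0 (t - t₀) ⊆ Ioo 0 t := Ioo_subset_Ioo_right (by linarith)
        rw [setIntegral_eq_of_subset_of_forall_sdiff_eq_zero measurableSet_Ioo hsub]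
        · set A := 2 * (B * M) * KK n * Real.exp ((a₀ + 2 * κ * (t - t₀)) * ‖x‖ ^ 2) with hA
          have hA0 : 0 ≤ A := by positivity
          have hb : ‖∫ τ in Ioo 0 (t - t₀), PA (√τ) (fun y => h y (t - τ)) x‖ ≤
              ∫ τ in Ioo 0 (t - t₀), A * ((1 + ‖x‖ ^ 2) * Real.exp (-(κ * τ) * ‖x‖ ^ 2)) := by
            refine norm_integral_le_of_norm_le ?_ ?_
            · have hc : Continuous fun τ : ℝ => A * ((1 + ‖x‖ ^ 2) * Real.exp (-(κ * τ) * ‖x‖ ^ 2)) := by fun_prop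
              exact (hc.integrableOn_Icc (a := 0) (b := t - t₀)).mono_set Ioo_subset_Icc_self
            · refine (ae_restrict_iff' measurableSet_Ioo).2 (Eventually.of_forall fun τ hτ => ?_)
              have hs : t - τ ∈ Ioo 0 T := ⟨by linarith [hτ.2], by linarith [hτ.1, ht.2]⟩
              have hs1 : t₀ < t - τ := by linarith [hτ.2]
              have hs2 : t - τ ≤ t₀ + θ := by linarith [hτ.1]
              have hb0 : 0 ≤ κ * (t - τ - t₀) := mul_nonneg hκ0.le (by linarith)
              have hb1 : κ * (t - τ - t₀) ≤ κ * θ := by gcongr; linarith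
              have hp := uniq_pt (n := n) (κ := κ) (τ := τ) (b := a₀ + 2 * κ * (t - τ - t₀)) (D := B * M) hκ16 hτ.1.le
                (by linarith [hτ.2]) (by linarith) (by linarith) (by positivity)
                (g := fun y => h y (t - τ)) (fun y => by
                  refine (hh y _ hs).trans ?_
                  have := ih y _ hs hs1 hs2
                  calc B * (1 + ‖y‖ ^ 2) * |W y (t - τ)| ≤ B * (1 + ‖y‖ ^ 2) * (M * Real.exp ((a₀ + 2 * κ * (t - τ - t₀)) * ‖y‖ ^ 2)) := by gcongr
                    _ = _ := by ring) x
              refine hp.trans (le_of_eq ?_)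
              have he : Real.exp ((a₀ + 2 * κ * (t - τ - t₀) + κ * τ) * ‖x‖ ^ 2) =
                  Real.exp ((a₀ + 2 * κ * (t - t₀)) * ‖x‖ ^ 2) * Real.exp (-(κ * τ) * ‖x‖ ^ 2) := by
                rw [← Real.exp_add]; congr 1; ring
              rw [he, hA]; ring
          refine hb.trans ?_
          rw [integral_const_mul]
          have htm := uniq_time (κ := κ) (X := ‖x‖ ^ 2) (η := t - t₀) (sq_nonneg _) hκ0 (by linarith) (by
            have : θ ≤ 1 / κ := by rw [hθ]; apply one_div_le_one_div_of_le <;> linarith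
            linarith)
          have h5 : 2 * (B * M) * KK n * (2 / κ) ≤ M * (1 / 2) := by
            have e : 2 * (B * M) * KK n * (2 / κ) = M * (4 * (B * KK n) / κ) := by ring
            rw [e]
            refine mul_le_mul_of_nonneg_left ?_ hM0
            rw [div_le_iff₀ hκ0]; nlinarith
          calc A * ∫ τ in Ioo 0 (t - t₀), (1 + ‖x‖ ^ 2) * Real.exp (-(κ * τ) * ‖x‖ ^ 2) ≤ A * (2 / κ) := by gcongr
            _ = (2 * (B * M) * KK n * (2 / κ)) * Real.exp ((a₀ + 2 * κ * (t - t₀)) * ‖x‖ ^ 2) := by rw [hA]; ring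
            _ ≤ (M * (1 / 2)) * Real.exp ((a₀ + 2 * κ * (t - t₀)) * ‖x‖ ^ 2) := by gcongr
            _ = _ := by rw [hMdef, pow_succ]; ring
        · intro τ hτ
          have h3 : t - t₀ ≤ τ := by
            by_contra hc
            exact hτ.2 ⟨hτ.1.1, not_le.1 hc⟩
          have hs : t - τ ∈ Ioo 0 T := ⟨by linarith [hτ.1.2], by linarith [hτ.1.1, ht.2]⟩
          have : (fun y => h y (t - τ)) = fun _ => (0 : ℝ) := by
            ext y
            have h6 := hh y _ hs
            rw [hzero y _ hs (by linarith), abs_zero, mul_zero] at h6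
            exact norm_le_zero_iff.1 h6
          rw [this, PA_const]
    intro x t ht hle
    rcases le_or_gt t t₀ with h1 | h1
    · exact hzero x t ht h1
    · have hlim : Tendsto (fun k : ℕ => M₀ * (1 / 2 : ℝ) ^ k * Real.exp ((a₀ + 2 * κ * (t - t₀)) * ‖x‖ ^ 2)) atTop (𝓝 0) := by
        simpa using ((tendsto_pow_atTop_nhds_zero_of_lt_one (r := (1/2:ℝ)) (by norm_num) (by norm_num)).const_mul M₀).mul_const
          (Real.exp ((a₀ + 2 * κ * (t - t₀)) * ‖x‖ ^ 2))
      have := ge_of_tendsto' hlim (fun k => hk k x t ht h1 hle)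
      exact abs_nonpos_iff.1 this
  have hind : ∀ k : ℕ, ∀ x, ∀ t ∈ Ioo 0 T, t ≤ k * θ → W x t = 0 := by
    intro k
    induction k with
    | zero => intro x t ht h; simp at h; linarith [ht.1]
    | succ k ih =>
      intro x t ht h
      refine key (k * θ) (by positivity) ih x t ht ?_
      push_cast at h; linarith
  intro x t ht
  obtain ⟨k, hk⟩ := exists_nat_ge (t / θ)
  exact hind k x t ht (by rwa [div_le_iff₀ hθ0] at hk)

theorem uniq_thm {ν T : ℝ} (hν : 0 < ν) {u₀ : E n → ℝ} {u v : E n → ℝ → ℝ}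
    (hu : IsCauchySol n ν T u₀ u) (hur : HeatRepr n ν T u₀ u) (hv : IsCauchySol n ν T u₀ v) (hvr : HeatRepr n ν T u₀ v) :
    ∀ x, ∀ t ∈ Ioo 0 T, u x t = v x t := by
  intro x t ht
  rw [heatRepr_iff] at hur hvr
  set T' := (t + T) / 2 with hT'
  have hT'0 : 0 < T' := by have := ht.1; have := ht.2; rw [hT']; linarith
  have hT'T : T' < T := by have := ht.2; rw [hT']; linarith
  have hd : T - T' ∈ Ioo 0 T := ⟨by linarith, by linarith⟩
  obtain ⟨c₁, _, hc₁, _, hb₁⟩ := hu.bound _ hd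
  obtain ⟨c₂, _, hc₂, _, hb₂⟩ := hv.bound _ hd
  rw [sub_sub_cancel] at hb₁ hb₂
  set c := min c₁ c₂ with hc
  have hc0 : 0 < c := lt_min hc₁ hc₂
  have hlu : ∀ x, ∀ t ∈ Ioo 0 T', c * (1 + ‖x‖ ^ 2) ^ (-(1 / (1 + ν))) ≤ u x t := fun x t ht =>
    le_trans (mul_le_mul_of_nonneg_right (min_le_left _ _) (by positivity)) (hb₁ x t ht).1
  have hlv : ∀ x, ∀ t ∈ Ioo 0 T', c * (1 + ‖x‖ ^ 2) ^ (-(1 / (1 + ν))) ≤ v x t := fun x t ht =>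
    le_trans (mul_le_mul_of_nonneg_right (min_le_right _ _) (by positivity)) (hb₂ x t ht).1
  have hIoo : Ioo 0 T' ⊆ Ioo 0 T := Ioo_subset_Ioo_right hT'T.le
  have huc := hu.reg.cont.mono (prod_mono_right (s := univ) hIoo)
  have hvc := hv.reg.cont.mono (prod_mono_right (s := univ) hIoo)
  set a := min (1 / 4) (1 / (16 * T')) with ha
  have ha0 : 0 < a := lt_min (by norm_num) (by positivity)
  have haT : 16 * a * T' ≤ 1 := by
    calc 16 * a * T' ≤ 16 * (1 / (16 * T')) * T' := by gcongr; exact min_le_right _ _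
      _ = 1 := by field_simp
  have hf := nl_gr hν hc0 ha0 huc hlu hν.le (by linarith)
  have hg := nl_gr hν hc0 ha0 hvc hlv hν.le (by linarith)
  have hW : ∀ x, ∀ t ∈ Ioo 0 T', u x t - v x t = SS (fun y s => v y s ^ (-ν) - u y s ^ (-ν)) x t := by
    intro x t ht
    rw [SS_sub ha0.le haT hg hf ht.2.le, hur x t (hIoo ht), hvr x t (hIoo ht)]; ring
  have hCf := hf.nn
  have h0 := uniq_abs (T := T') (a₀ := 2 * a) (B := ν * c ^ (-(1 + ν)))
    (M₀ := KK n * (c ^ (-ν) * (1 + 1 / a)) * T' + KK n * (c ^ (-ν) * (1 + 1 / a)) * T')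
    (W := fun x t => u x t - v x t) (h := fun y s => v y s ^ (-ν) - u y s ^ (-ν))
    (by positivity) (by have : a ≤ 1 / 4 := min_le_left _ _; linarith) (by positivity)
    (by have := KK_pos (n := n); positivity) hW ?_ ?_ x t ⟨ht.1, by have := ht.2; rw [hT']; linarith⟩
  · exact sub_eq_zero.1 h0
  · intro y s hs
    set m := c * (1 + ‖y‖ ^ 2) ^ (-(1 / (1 + ν))) with hm
    have hm0 : 0 < m := by positivity
    rw [Real.norm_eq_abs]
    refine (rpow_neg_lip hν hm0 (hlv y s hs) (hlu y s hs)).trans ?_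
    rw [abs_sub_comm]
    have := lb_pow (p := 1 + ν) hν hc0 (by linarith) le_rfl (sq_nonneg ‖y‖) hm.ge
    rw [mul_assoc ν (c ^ (-(1 + ν)))]
    exact mul_le_mul_of_nonneg_right (mul_le_mul_of_nonneg_left this hν.le) (abs_nonneg _)
  · intro y s hs
    rw [hW y s hs, SS_sub ha0.le haT hg hf hs.2.le, add_mul, ← Real.norm_eq_abs]
    exact (norm_sub_le _ _).trans (add_le_add (SS_norm_le hT'0.le ha0.le haT hg hs.2.le y)
      (SS_norm_le hT'0.le ha0.le haT hf hs.2.le y))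

end uniqthm

section finalthm
variable {n : ℕ}

lemma SS_congr {f g : E n → ℝ → ℝ} {t : ℝ} (h : ∀ y, ∀ s ∈ Ioo 0 t, f y s = g y s) (x : E n) :
    SS f x t = SS g x t := by
  rw [SS, SS, NN_shift, NN_shift]
  refine setIntegral_congr_fun measurableSet_Ioo fun s hs => ?_
  have : (fun y => f y s) = fun y => g y s := by ext y; exact h y s hs
  simp only [this]

lemma weight_le_one {ν : ℝ} (hν : 0 < ν) (x : E n) : (1 + ‖x‖ ^ 2) ^ (-(1 / (1 + ν))) ≤ 1 := by
  apply Real.rpow_le_one_of_one_le_of_nonpos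
  · nlinarith [sq_nonneg ‖x‖]
  · have : 0 < 1 / (1 + ν) := by positivity
    linarith

lemma local_sol {ν a T ε C₀ : ℝ} {u₀ : E n → ℝ} (hν : 0 < ν) (ha : 0 < a) (hT : 0 < T)
    (haT : 128 * a * T ≤ 1) (hε : 0 < ε) (hu₀ : Gs C₀ a u₀) (hlow : ∀ x, ε ≤ u₀ x)
    (hTε : T ≤ (ε / 2) ^ (1 + ν)) :
    ∃ u : E n → ℝ → ℝ, IsCauchySol n ν T u₀ u ∧ HeatRepr n ν T u₀ u := by
  have h16 : 16 * a * T ≤ 1 := by have := mul_pos ha hT; linarith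
  obtain ⟨w, hwc, _, hwl, hwr⟩ := exist_thm hν ha.le hT h16 hε hu₀ hlow hTε
  have hr : ∀ x, ∀ t ∈ Ioo 0 T, w x t = PA (√t) u₀ x - SS (fun y s => w y s ^ (-ν)) x t :=
    fun x t ht => hwr x t (Ioo_subset_Icc_self ht)
  refine ⟨w, ?_, heatRepr_iff.2 hr⟩
  refine reg_thm hν ha hT haT (half_pos hε) hu₀ (hwc.mono (prod_mono_right Ioo_subset_Icc_self)) ?_ hr
  intro x t ht
  refine le_trans ?_ (hwl x t (Ioo_subset_Icc_self ht))
  have := weight_le_one hν x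
  have h2 : 0 < ε / 2 := half_pos hε
  nlinarith

lemma poly_gs {C α : ℝ} {u₀ : E n → ℝ} (hC : 0 < C) (hα : 0 < α) (hc : Continuous u₀) (hpos : ∀ x, 0 ≤ u₀ x)
    (hu : ∀ x, u₀ x ≤ C * (1 + ‖x‖ ^ 2) ^ α) {a : ℝ} (ha : 0 < a) : ∃ C', Gs C' a u₀ := by
  have hb : 0 < a / α := by positivity
  refine ⟨C * (1 + 1 / (a / α)) ^ α, hc, fun x => ?_⟩
  rw [Real.norm_of_nonneg (hpos x)]
  refine (hu x).trans ?_
  have h1 := one_add_le_exp_mul hb (sq_nonneg ‖x‖)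
  have h2 : (1 + ‖x‖ ^ 2) ^ α ≤ ((1 + 1 / (a / α)) * Real.exp (a / α * ‖x‖ ^ 2)) ^ α :=
    Real.rpow_le_rpow (by positivity) h1 hα.le
  rw [Real.mul_rpow (by positivity) (Real.exp_pos _).le, ← Real.exp_mul] at h2
  have e : a / α * ‖x‖ ^ 2 * α = a * ‖x‖ ^ 2 := by field_simp
  rw [e] at h2
  rw [mul_assoc]
  gcongr

/-- continuation past a time where the infimum is positive -/
lemma extend_sol {ν a Tm t₀ ε C₀ : ℝ} {u₀ : E n → ℝ} {u : E n → ℝ → ℝ} (hν : 0 < ν) (ha : 0 < a)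
    (ht₀ : t₀ ∈ Ioo 0 Tm) (hε : 0 < ε) (haT : 128 * a * (t₀ + (ε / 2) ^ (1 + ν)) ≤ 1) (haTm : 16 * a * Tm ≤ 1)
    (hu₀ : Gs C₀ a u₀)
    (hu : IsCauchySol n ν Tm u₀ u) (hur : HeatRepr n ν Tm u₀ u) (hlow : ∀ x, ε ≤ u x t₀) :
    ∃ v : E n → ℝ → ℝ, IsCauchySol n ν (t₀ + (ε / 2) ^ (1 + ν)) u₀ v ∧
      HeatRepr n ν (t₀ + (ε / 2) ^ (1 + ν)) u₀ v := by
  set L := (ε / 2) ^ (1 + ν) with hL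
  have hε2 : 0 < ε / 2 := half_pos hε
  have hL0 : 0 < L := by positivity
  have ht0 := ht₀.1
  have ht1 := ht₀.2
  have haL := mul_pos ha hL0
  have hat := mul_pos ha ht0
  rw [heatRepr_iff] at hur
  -- lower bound near t₀
  set T₁ := (t₀ + Tm) / 2 with hT₁
  have hT1a : t₀ < T₁ := by rw [hT₁]; linarith
  have hT1b : T₁ < Tm := by rw [hT₁]; linarith
  obtain ⟨c₁, _, hc₁, _, hb₁⟩ := hu.bound (Tm - T₁) ⟨by linarith, by linarith⟩
  rw [sub_sub_cancel] at hb₁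
  have hlu : ∀ x, ∀ t ∈ Ioo 0 T₁, c₁ * (1 + ‖x‖ ^ 2) ^ (-(1 / (1 + ν))) ≤ u x t := fun x t ht => (hb₁ x t ht).1
  have hIoo : Ioo 0 T₁ ⊆ Ioo 0 Tm := Ioo_subset_Ioo_right hT1b.le
  have huc := hu.reg.cont.mono (prod_mono_right (s := univ) hIoo)
  obtain ⟨Cf, hf⟩ : ∃ Cf, Gr T₁ Cf a (fun y s => u y s ^ (-ν)) := ⟨_, nl_gr hν hc₁ ha huc hlu hν.le (by linarith)⟩
  have haT₁ : 16 * a * T₁ ≤ 1 := by nlinarith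
  -- data at t₀
  have hgs : Gs (KK n * C₀ + KK n * Cf * T₁) (2 * a) (fun x => u x t₀) := by
    refine ⟨?_, fun x => ?_⟩
    · rw [← continuousOn_univ]
      exact hu.reg.cont.comp (f := fun y : E n => (y, t₀)) (by fun_prop) (fun y _ => ⟨mem_univ _, ht₀⟩)
    · rw [hur x t₀ ht₀, add_mul]
      exact (norm_sub_le _ _).trans (add_le_add
        (AA_norm_le one_bd ha.le (sq_sqrt_le ha.le haT₁ ht0.le hT1a.le) hu₀.bd x)
        (SS_norm_le (by linarith) ha.le haT₁ hf hT1a.le x))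
  obtain ⟨w, hwc, hw0, hwl, hwr⟩ := exist_thm (T := L) hν (a := 2 * a) (by positivity) hL0
    (by nlinarith) hε hgs hlow le_rfl
  set v : E n → ℝ → ℝ := fun x t => u x (min t t₀) + (w x (max (t - t₀) 0) - w x 0) with hv
  have hvl : ∀ x t, t ≤ t₀ → v x t = u x t := by
    intro x t ht
    simp only [hv]
    rw [min_eq_left ht, max_eq_right (by linarith)]; ring
  have hvr : ∀ x t, t₀ ≤ t → v x t = w x (t - t₀) := by
    intro x t ht
    simp only [hv]
    rw [min_eq_right ht, max_eq_left (by linarith), hw0]; ring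
  have hvc : ContinuousOn (fun p : E n × ℝ => v p.1 p.2) (univ ×ˢ Ioo 0 (t₀ + L)) := by
    refine ContinuousOn.add ?_ (ContinuousOn.sub ?_ ?_)
    · refine hu.reg.cont.comp (f := fun p : E n × ℝ => (p.1, min p.2 t₀)) (by fun_prop) ?_
      rintro ⟨x, t⟩ ⟨_, ht⟩
      exact ⟨mem_univ _, lt_min ht.1 ht0, (min_le_right _ _).trans_lt ht1⟩
    · refine hwc.comp (f := fun p : E n × ℝ => (p.1, max (p.2 - t₀) 0)) (by fun_prop) ?_
      rintro ⟨x, t⟩ ⟨_, ht⟩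
      exact ⟨mem_univ _, le_max_right _ _, max_le (by have := ht.2; simp only at this ⊢; linarith) hL0.le⟩
    · refine hwc.comp (f := fun p : E n × ℝ => (p.1, (0 : ℝ))) (by fun_prop) ?_
      rintro ⟨x, t⟩ ⟨_, ht⟩
      exact ⟨mem_univ _, le_rfl, hL0.le⟩
  set c := min c₁ (ε / 2) with hc
  have hc0 : 0 < c := lt_min hc₁ hε2
  have hvlow : ∀ x, ∀ t ∈ Ioo 0 (t₀ + L), c * (1 + ‖x‖ ^ 2) ^ (-(1 / (1 + ν))) ≤ v x t := by
    intro x t ht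
    rcases le_total t t₀ with h | h
    · rw [hvl x t h]
      exact le_trans (mul_le_mul_of_nonneg_right (min_le_left _ _) (by positivity)) (hlu x t ⟨ht.1, by linarith⟩)
    · rw [hvr x t h]
      refine le_trans ?_ (hwl x (t - t₀) ⟨by linarith, by linarith [ht.2]⟩)
      have h1 := weight_le_one hν x
      have h2 : c ≤ ε / 2 := min_le_right _ _
      nlinarith
  obtain ⟨Cg, hg⟩ : ∃ Cg, Gr (t₀ + L) Cg a (fun y s => v y s ^ (-ν)) :=
    ⟨_, nl_gr hν hc0 ha hvc hvlow hν.le (by linarith)⟩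
  have hS : ∀ x t, t ≤ t₀ → SS (fun y s => v y s ^ (-ν)) x t = SS (fun y s => u y s ^ (-ν)) x t := by
    intro x t ht
    refine SS_congr (fun y s hs => ?_) x
    rw [hvl y s (hs.2.le.trans ht)]
  have hrep : ∀ x, ∀ t ∈ Ioo 0 (t₀ + L), v x t = PA (√t) u₀ x - SS (fun y s => v y s ^ (-ν)) x t := by
    intro x t ht
    rcases le_or_gt t t₀ with h | h
    · rw [hvl x t h, hS x t h]
      exact hur x t ⟨ht.1, by linarith⟩
    · have hτ : 0 < t - t₀ := by linarith
      have hr := restart (T := t₀ + L) (τ := t - t₀) (h := fun x => u x t₀) ha.le (by linarith) hu₀ hg ht0 hτ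
        (by linarith [ht.2]) (fun x => by rw [hS x t₀ le_rfl]; exact hur x t₀ ht₀) x
      rw [add_sub_cancel] at hr
      rw [← hr, hvr x t h.le, hwr x (t - t₀) ⟨hτ.le, by linarith [ht.2]⟩]
      congr 1
      refine SS_congr (fun y s hs => ?_) x
      rw [hvr y (t₀ + s) (by linarith [hs.1]), add_sub_cancel_left]
  exact ⟨v, reg_thm hν ha (by linarith) haT hc0 hu₀ hvc hvlow hrep, heatRepr_iff.2 hrep⟩

end finalthm

/-- Local existence and uniqueness, lower bound on the maximal existence time,
and extinction at the maximal time (Theorem 1.6). -/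
theorem local_existence (n : ℕ) (hn : 1 ≤ n) (ν : ℝ) (hν : 0 < ν)
    (u₀ : E n → ℝ) (hu₀c : Continuous u₀)
    (δ : ℝ) (hδpos : 0 < δ) (hδ : IsGLB (range u₀) δ)
    (C₁ C₂ : ℝ) (hC₁ : 0 < C₁) (hC₂ : 0 < C₂)
    (hu₀u : ∀ x : E n, u₀ x ≤ C₁ * Real.exp (C₂ * ‖x‖ ^ 2)) :
    (∃ T > (0 : ℝ),
      (∃ u : E n → ℝ → ℝ, IsCauchySol n ν T u₀ u ∧ HeatRepr n ν T u₀ u) ∧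
      ∀ u v : E n → ℝ → ℝ,
        IsCauchySol n ν T u₀ u → HeatRepr n ν T u₀ u →
        IsCauchySol n ν T u₀ v → HeatRepr n ν T u₀ v →
        ∀ (x : E n), ∀ t ∈ Ioo (0 : ℝ) T, u x t = v x t) ∧
    ∀ C₃ α : ℝ, 0 < C₃ → 1 / (1 + ν) ≤ α →
      (∀ x : E n, u₀ x ≤ C₃ * (1 + ‖x‖ ^ 2) ^ α) →
      (∃ u : E n → ℝ → ℝ, IsCauchySol n ν ((δ / 2) ^ (1 + ν)) u₀ u ∧
        HeatRepr n ν ((δ / 2) ^ (1 + ν)) u₀ u) ∧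
      ∀ (Tm : ℝ) (u : E n → ℝ → ℝ),
        IsCauchySol n ν Tm u₀ u → HeatRepr n ν Tm u₀ u →
        (∀ T' > Tm, ¬ ∃ v : E n → ℝ → ℝ,
          IsCauchySol n ν T' u₀ v ∧ HeatRepr n ν T' u₀ v) →
        Tendsto (fun t => ⨅ x : E n, u x t) (𝓝[<] Tm) (𝓝 0) := by
  have hlow : ∀ x, δ ≤ u₀ x := fun x => hδ.1 ⟨x, rfl⟩
  have hnn : ∀ x, 0 ≤ u₀ x := fun x => hδpos.le.trans (hlow x)
  have hTδ : 0 < (δ / 2) ^ (1 + ν) := by positivity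
  constructor
  · set T := min ((δ / 2) ^ (1 + ν)) (1 / (128 * C₂)) with hT
    have hT0 : 0 < T := lt_min hTδ (by positivity)
    have haT : 128 * C₂ * T ≤ 1 := by
      calc 128 * C₂ * T ≤ 128 * C₂ * (1 / (128 * C₂)) := by gcongr; exact min_le_right _ _
        _ = 1 := by field_simp
    refine ⟨T, hT0, local_sol hν hC₂ hT0 haT hδpos (C₀ := C₁) ⟨hu₀c, fun x => ?_⟩ hlow (min_le_left _ _), ?_⟩
    · rw [Real.norm_of_nonneg (hnn x)]; exact hu₀u x
    · intro u v hu hur hv hvr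
      exact uniq_thm hν hu hur hv hvr
  · intro C₃ α hC₃ hα hpoly
    have hα0 : 0 < α := lt_of_lt_of_le (by positivity) hα
    have h2a : ∃ u : E n → ℝ → ℝ, IsCauchySol n ν ((δ / 2) ^ (1 + ν)) u₀ u ∧
        HeatRepr n ν ((δ / 2) ^ (1 + ν)) u₀ u := by
      have ha : 0 < 1 / (128 * (δ / 2) ^ (1 + ν)) := by positivity
      obtain ⟨C', hC'⟩ := poly_gs hC₃ hα0 hu₀c hnn hpoly ha
      refine local_sol hν ha hTδ (le_of_eq ?_) hδpos hC' hlow le_rfl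
      field_simp
    refine ⟨h2a, ?_⟩
    intro Tm u hu hur hmax
    have hTm : 0 < Tm := by
      by_contra hc
      exact hmax _ (lt_of_le_of_lt (not_lt.1 hc) hTδ) h2a
    by_contra hnt
    rw [Metric.tendsto_nhds] at hnt
    push Not at hnt
    obtain ⟨ε, hε, hfr⟩ := hnt
    have hL0 : 0 < (ε / 2) ^ (1 + ν) := by positivity
    have hev : ∀ᶠ t in 𝓝[<] Tm, t ∈ Ioo (max 0 (Tm - (ε / 2) ^ (1 + ν))) Tm :=
      Ioo_mem_nhdsLT (max_lt hTm (by linarith))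
    obtain ⟨t₀, hd, ht₀⟩ := (hfr.and_eventually hev).exists
    have ht0 : 0 < t₀ := (le_max_left _ _).trans_lt ht₀.1
    have htL : Tm - (ε / 2) ^ (1 + ν) < t₀ := (le_max_right _ _).trans_lt ht₀.1
    have hpos : ∀ x, 0 < u x t₀ := fun x => hu.pos x t₀ ⟨ht0, ht₀.2⟩
    have hinf : 0 ≤ ⨅ x : E n, u x t₀ := Real.iInf_nonneg fun x => (hpos x).le
    rw [Real.dist_eq, sub_zero, abs_of_nonneg hinf] at hd
    have hlow0 : ∀ x, ε ≤ u x t₀ := fun x =>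
      hd.trans (ciInf_le ⟨0, by rintro _ ⟨y, rfl⟩; exact (hpos y).le⟩ x)
    have hTp : 0 < t₀ + (ε / 2) ^ (1 + ν) := by linarith
    have ha : 0 < 1 / (128 * (t₀ + (ε / 2) ^ (1 + ν))) := by positivity
    obtain ⟨C', hC'⟩ := poly_gs hC₃ hα0 hu₀c hnn hpoly ha
    have haT : 128 * (1 / (128 * (t₀ + (ε / 2) ^ (1 + ν)))) * (t₀ + (ε / 2) ^ (1 + ν)) ≤ 1 := by
      apply le_of_eq; field_simp
    refine hmax (t₀ + (ε / 2) ^ (1 + ν)) (by linarith) (extend_sol hν ha ⟨ht0, ht₀.2⟩ hε haT ?_ hC' hu hur hlow0)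
    refine le_trans ?_ haT
    gcongr
    · norm_num
    · linarith
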